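/- arXiv:2211.13158 — 9 statements merged into one kernel-verified Lean document; each statement's English description precedes it below -/
import Mathlib

section
/- Let E ⊆ ℝ³ be any set containing the origin. If both the polynomial p₁(x,y,z) = x² + y² and the polynomial p₂(x,y,z) = xz belong to I²(E), then the polynomial x² also belongs to I²(E). -/
open MvPolynomial Filter Asymptotics Topology

/-- `p ∈ Iᵐ(E)`: `p` has total degree at most `m` and there is a `Cᵐ` function `F`
vanishing everywhere on `E` with `F(v) - p(v) = o(‖v‖^m)` as `v → 0`, i.e. `p` is the
`m`-th degree Taylor polynomial of `F` at the origin. -/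
def Im (n m : ℕ) (E : Set (Fin n → ℝ)) : Set (MvPolynomial (Fin n) ℝ) :=
  {p | p.totalDegree ≤ m ∧ ∃ F : (Fin n → ℝ) → ℝ, ContDiff ℝ m F ∧ (∀ x ∈ E, F x = 0) ∧
    (fun v => F v - eval v p) =o[𝓝 (0 : Fin n → ℝ)] (fun v => ‖v‖ ^ m)}

/-- The truncated ideal `⟨ps⟩_m`: polynomials `p` of degree at most `m` such that for some
polynomials `qᵢ`, all monomials of degree at most `m` in `p - ∑ qᵢ · psᵢ` vanish. -/
def truncIdeal (n m : ℕ) {ι : Type} [Fintype ι] (ps : ι → MvPolynomial (Fin n) ℝ) :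
    Set (MvPolynomial (Fin n) ℝ) :=
  {p | p.totalDegree ≤ m ∧ ∃ q : ι → MvPolynomial (Fin n) ℝ,
    ∀ d : Fin n →₀ ℕ, (d.sum fun _ e => e) ≤ m →
      coeff d (p - ∑ i, q i * ps i) = 0}

section FlatMultiplier

lemma apply_zero_of_isLittleO {V W : Type*} [NormedAddCommGroup V] [NormedAddCommGroup W]
    {R : V → W} {k : ℕ} (hk : k ≠ 0) (h : R =o[𝓝 0] fun v : V => ‖v‖ ^ k) : R 0 = 0 := by
  have := (isLittleO_iff.1 h one_pos).self_of_nhds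
  simpa [hk] using this

lemma isLittleO_norm_sq_norm {V : Type*} [NormedAddCommGroup V] :
    (fun v : V => ‖v‖ ^ 2) =o[𝓝 0] fun v : V => ‖v‖ := by
  simpa using isLittleO_norm_pow_id (E' := V) one_lt_two |>.norm_right

lemma isLittleO_nhds_zero_of_punctured {V W : Type*} [NormedAddCommGroup V]
    [NormedAddCommGroup W] {g : V → W} {k : ℕ} (hg : g 0 = 0)
    (h : (fun v => ‖g v‖) =o[𝓝[≠] 0] fun v : V => ‖v‖ ^ k) :
    g =o[𝓝 0] fun v : V => ‖v‖ ^ k := by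
  have : insert (0 : V) {0}ᶜ = Set.univ := by ext; simp [em]
  rw [← nhdsWithin_univ, ← this]
  exact (isLittleO_insert hg).2 h.of_norm_left

variable {V : Type*} [NormedAddCommGroup V] [NormedSpace ℝ V]
  {W : Type*} [NormedAddCommGroup W] [NormedSpace ℝ W]

lemma isLittleO_norm_sq_of_fderiv {h : V → W} (hd : Differentiable ℝ h) (h0 : h 0 = 0)
    (hf : fderiv ℝ h =o[𝓝 0] fun v : V => ‖v‖) : h =o[𝓝 0] fun v : V => ‖v‖ ^ 2 := by
  rw [isLittleO_iff] at hf ⊢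
  intro c hc
  obtain ⟨δ, hδ, H⟩ := Metric.eventually_nhds_iff.1 (hf hc)
  refine Metric.eventually_nhds_iff.2 ⟨δ, hδ, fun v hv => ?_⟩
  rw [dist_zero_right] at hv
  have key := (convex_closedBall (0 : V) ‖v‖).norm_image_sub_le_of_norm_fderiv_le (𝕜 := ℝ)
    (f := h) (C := c * ‖v‖) (x := 0) (y := v) (fun x _ => hd x) (fun x hx => by
      rw [mem_closedBall_zero_iff] at hx
      have h1 := H (y := x) (by rw [dist_zero_right]; linarith)
      rw [norm_norm] at h1
      exact h1.trans (by gcongr)) (by simp) (by simp)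
  simp only [h0, sub_zero] at key
  rw [norm_pow, norm_norm]
  linarith

lemma bilin_diag_eq_zero_of_isLittleO (L : V →L[ℝ] V →L[ℝ] W)
    (hL : (fun v => L v v) =o[𝓝 0] fun v : V => ‖v‖ ^ 2) (v : V) : L v v = 0 := by
  have key : ∀ c : ℝ, 0 < c → ‖L v v‖ ≤ c * ‖v‖ ^ 2 := by
    intro c hc
    have ht : Tendsto (fun t : ℝ => t • v) (𝓝[≠] 0) (𝓝 0) := by
      have : Continuous fun t : ℝ => t • v := by fun_prop
      simpa using (this.tendsto 0).mono_left nhdsWithin_le_nhds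
    obtain ⟨t, h1, h2⟩ :=
      ((ht.eventually (isLittleO_iff.1 hL hc)).and self_mem_nhdsWithin).exists
    have h2 : 0 < |t| ^ 2 := by have := abs_pos.2 h2; positivity
    rw [map_smul, map_smul, smul_apply, norm_smul, norm_smul, norm_pow, norm_norm, norm_smul,
      Real.norm_eq_abs, mul_pow] at h1
    refine le_of_mul_le_mul_left ?_ h2
    linarith
  have h3 : ‖L v v‖ ≤ 0 := by
    have ht : Tendsto (fun c : ℝ => c * ‖v‖ ^ 2) (𝓝[>] 0) (𝓝 0) := by
      have : Continuous fun c : ℝ => c * ‖v‖ ^ 2 := by fun_prop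
      simpa using (this.tendsto 0).mono_left nhdsWithin_le_nhds
    exact ge_of_tendsto ht (by filter_upwards [self_mem_nhdsWithin] with c hc using key c hc)
  exact norm_le_zero_iff.1 h3

lemma hasFDerivAt_zero_of_isLittleO {R : V → W} (h : R =o[𝓝 0] fun v : V => ‖v‖) :
    HasFDerivAt R (0 : V →L[ℝ] W) 0 := by
  have h0 : R 0 = 0 := apply_zero_of_isLittleO one_ne_zero (by simpa using h)
  rw [hasFDerivAt_iff_isLittleO_nhds_zero]
  simpa [h0] using h.of_norm_right

lemma fderiv_zero_of_isLittleO {R : V → W}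
    (h : R =o[𝓝 0] fun v : V => ‖v‖ ^ 2) : fderiv ℝ R 0 = 0 :=
  (hasFDerivAt_zero_of_isLittleO (h.trans isLittleO_norm_sq_norm)).fderiv

lemma fderiv_fderiv_zero_of_isLittleO {R : V → W} (hR : ContDiff ℝ 2 R)
    (h : R =o[𝓝 0] fun v : V => ‖v‖ ^ 2) : fderiv ℝ (fderiv ℝ R) 0 = 0 := by
  set L := fderiv ℝ (fderiv ℝ R) 0
  have hsymm : ∀ v w, L v w = L w v :=
    hR.contDiffAt.isSymmSndFDerivAt (n := 2) (by simp)
  have hD : ContDiff ℝ 1 (fderiv ℝ R) := hR.fderiv_right (by norm_num)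
  have hL : HasFDerivAt (fderiv ℝ R) L 0 := (hD.differentiable (by simp) 0).hasFDerivAt
  have hquad : ∀ v, HasFDerivAt (fun v => (2⁻¹ : ℝ) • L v v) (L v) v := by
    intro v
    have h1 := (L.hasFDerivAt (x := v)).clm_apply (hasFDerivAt_id v) |>.const_smul (2⁻¹ : ℝ)
    refine h1.congr_fderiv ?_
    ext w
    simp [hsymm w v, ← two_smul ℝ, smul_smul]
  have hRd : Differentiable ℝ R := hR.differentiable (by simp)
  have hder : ∀ v, HasFDerivAt (fun v => R v - (2⁻¹ : ℝ) • L v v) (fderiv ℝ R v - L v) v :=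
    fun v => (hRd v).hasFDerivAt.sub (hquad v)
  have h2 : (fun v => R v - (2⁻¹ : ℝ) • L v v) =o[𝓝 0] fun v : V => ‖v‖ ^ 2 := by
    refine isLittleO_norm_sq_of_fderiv (fun v => (hder v).differentiableAt)
      (by simp [apply_zero_of_isLittleO two_ne_zero h]) ?_
    have : fderiv ℝ (fun v => R v - (2⁻¹ : ℝ) • L v v) = fun v => fderiv ℝ R v - L v :=
      funext fun v => (hder v).fderiv
    rw [this]
    rw [hasFDerivAt_iff_isLittleO_nhds_zero] at hL
    simpa [fderiv_zero_of_isLittleO h] using hL.norm_right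
  have h3 := bilin_diag_eq_zero_of_isLittleO ((2⁻¹ : ℝ) • L) (by
    simpa using h.sub h2)
  have h4 : ∀ v, L v v = 0 := fun v => by simpa using h3 v
  ext v w
  have h5 := h4 (v + w)
  simp only [map_add, add_apply, h4, hsymm w v, zero_add, add_zero,
    ← two_smul ℝ] at h5
  simpa using h5

lemma iteratedFDeriv_isLittleO {R : V → W} (hR : ContDiff ℝ 2 R)
    (h : R =o[𝓝 0] fun v : V => ‖v‖ ^ 2) {j : ℕ} (hj : j ≤ 2) :
    (fun v => ‖iteratedFDeriv ℝ j R v‖) =o[𝓝 0] fun v : V => ‖v‖ ^ (2 - j) := by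
  have h1 := fderiv_zero_of_isLittleO h
  have h2 := fderiv_fderiv_zero_of_isLittleO hR h
  have hD : ContDiff ℝ 1 (fderiv ℝ R) := hR.fderiv_right (by norm_num)
  interval_cases j
  · simpa using h.norm_left
  · simp only [norm_iteratedFDeriv_one]
    have := (hD.differentiable (by simp) 0).hasFDerivAt
    rw [h2, hasFDerivAt_iff_isLittleO_nhds_zero] at this
    simpa [h1] using this.norm_right.norm_left
  · simp only [← norm_iteratedFDeriv_fderiv (n := 1), norm_iteratedFDeriv_one]
    have := (hD.continuous_fderiv (by simp)).tendsto 0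
    rw [h2] at this
    simpa using this.norm

lemma contDiff_two_of_iteratedFDeriv_isLittleO {G : V → W} (hG : ContDiffOn ℝ 2 G {0}ᶜ)
    (h0 : G 0 = 0)
    (h : ∀ n ≤ 2, (fun v => ‖iteratedFDeriv ℝ n G v‖) =o[𝓝[≠] 0] fun v : V => ‖v‖ ^ (2 - n)) :
    ContDiff ℝ 2 G := by
  have hopen : IsOpen ({0}ᶜ : Set V) := isOpen_compl_singleton
  have hGo : G =o[𝓝 0] fun v : V => ‖v‖ ^ 2 := 
    isLittleO_nhds_zero_of_punctured h0 (by simpa using h 0 (by norm_num))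
  have hd1 : fderiv ℝ G 0 = 0 := fderiv_zero_of_isLittleO hGo
  have hG1 : fderiv ℝ G =o[𝓝 0] fun v : V => ‖v‖ := by
    simpa using isLittleO_nhds_zero_of_punctured (k := 1) hd1
      (by simpa [norm_iteratedFDeriv_one] using h 1 (by norm_num))
  have hG2 := hasFDerivAt_zero_of_isLittleO hG1
  have hDon : ContDiffOn ℝ 1 (fderiv ℝ G) {0}ᶜ := hG.fderiv_of_isOpen hopen (by norm_num)
  have hDDon : ContDiffOn ℝ 0 (fderiv ℝ (fderiv ℝ G)) {0}ᶜ :=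
    hDon.fderiv_of_isOpen hopen (by norm_num)
  rw [show (2 : WithTop ℕ∞) = 1 + 1 by norm_num, contDiff_succ_iff_fderiv,
    contDiff_one_iff_fderiv]
  refine ⟨fun v => ?_, by simp, fun v => ?_, continuous_iff_continuousAt.2 fun v => ?_⟩
  · rcases eq_or_ne v 0 with rfl | hv
    · exact (hasFDerivAt_zero_of_isLittleO (hGo.trans isLittleO_norm_sq_norm)).differentiableAt
    · exact (hG.contDiffAt (hopen.mem_nhds hv)).differentiableAt (by simp)
  · rcases eq_or_ne v 0 with rfl | hv
    · exact hG2.differentiableAt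
    · exact (hDon.contDiffAt (hopen.mem_nhds hv)).differentiableAt (by simp)
  · rcases eq_or_ne v 0 with rfl | hv
    · have h2 := isLittleO_nhds_zero_of_punctured (k := 0) hG2.fderiv (by
        simpa [← norm_iteratedFDeriv_fderiv (n := 1), norm_iteratedFDeriv_one] using h 2 le_rfl)
      rw [ContinuousAt, hG2.fderiv]
      simpa using h2
    · exact (hDDon.contDiffAt (hopen.mem_nhds hv)).continuousAt

lemma isBigO_of_homogeneous [FiniteDimensional ℝ V] {g : V → W} {d : ℕ}
    (hg : ContinuousOn g {0}ᶜ) (hom : ∀ c : ℝ, 0 < c → ∀ v, c ^ d • g (c • v) = g v) :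
    (fun v => ‖g v‖) =O[𝓝[≠] 0] fun v : V => (‖v‖ ^ d)⁻¹ := by
  obtain ⟨C, hC⟩ := (isCompact_sphere (0 : V) 1).exists_bound_of_continuousOn
    (hg.mono fun v hv => by
      rintro rfl
      simp at hv)
  refine IsBigO.of_bound C ?_
  filter_upwards [self_mem_nhdsWithin] with v hv
  rw [norm_norm, norm_inv, norm_pow, norm_norm]
  have hpos : 0 < ‖v‖ := norm_pos_iff.2 hv
  rw [← hom ‖v‖⁻¹ (by positivity) v, norm_smul, mul_comm C]
  have := hC (‖v‖⁻¹ • v) (by simp [norm_smul, hpos.ne'])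
  rw [norm_pow, norm_inv, norm_norm, inv_pow]
  gcongr

lemma fderiv_homogeneous {g : V → W} {d : ℕ}
    (hom : ∀ c : ℝ, 0 < c → ∀ v, c ^ d • g (c • v) = g v) (c : ℝ) (hc : 0 < c) (v : V) :
    c ^ (d + 1) • fderiv ℝ g (c • v) = fderiv ℝ g v := by
  have h1 : g = c ^ d • fun v => g (c • v) := funext fun v => (hom c hc v).symm
  conv_rhs => rw [h1, fderiv_const_smul_field, Pi.smul_apply, fderiv_comp_smul, smul_smul]
  rw [pow_succ]

lemma iteratedFDeriv_isBigO_of_homogeneous [FiniteDimensional ℝ V] {χ : V → W}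
    (hχ : ContDiffOn ℝ 2 χ {0}ᶜ) (hom : ∀ c : ℝ, 0 < c → ∀ v, χ (c • v) = χ v)
    {i : ℕ} (hi : i ≤ 2) :
    (fun v => ‖iteratedFDeriv ℝ i χ v‖) =O[𝓝[≠] 0] fun v : V => (‖v‖ ^ i)⁻¹ := by
  have hopen : IsOpen ({0}ᶜ : Set V) := isOpen_compl_singleton
  have hDon : ContDiffOn ℝ 1 (fderiv ℝ χ) {0}ᶜ := hχ.fderiv_of_isOpen hopen (by norm_num)
  have hDDon : ContDiffOn ℝ 0 (fderiv ℝ (fderiv ℝ χ)) {0}ᶜ :=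
    hDon.fderiv_of_isOpen hopen (by norm_num)
  have hom0 : ∀ c : ℝ, 0 < c → ∀ v, c ^ 0 • χ (c • v) = χ v := by simpa using hom
  have hom1 := fderiv_homogeneous hom0
  have hom2 := fderiv_homogeneous (g := fderiv ℝ χ) hom1
  interval_cases i
  · simpa using isBigO_of_homogeneous hχ.continuousOn hom0
  · simpa [norm_iteratedFDeriv_one] using
      isBigO_of_homogeneous (g := fderiv ℝ χ) hDon.continuousOn hom1
  · simpa [← norm_iteratedFDeriv_fderiv (n := 1), norm_iteratedFDeriv_one] using
      isBigO_of_homogeneous (g := fderiv ℝ (fderiv ℝ χ)) hDDon.continuousOn hom2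

/-- A `C²` function vanishing to second order at the origin stays so after multiplication by a
function that is homogeneous of degree zero and `C²` away from the origin. -/
lemma contDiff_two_mul_of_homogeneous [FiniteDimensional ℝ V] {χ R : V → ℝ}
    (hχ : ContDiffOn ℝ 2 χ {0}ᶜ) (hom : ∀ c : ℝ, 0 < c → ∀ v, χ (c • v) = χ v)
    (hR : ContDiff ℝ 2 R) (h : R =o[𝓝 0] fun v : V => ‖v‖ ^ 2) :
    ContDiff ℝ 2 (fun v => χ v * R v) ∧
      (fun v => χ v * R v) =o[𝓝 0] fun v : V => ‖v‖ ^ 2 := by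
  have hopen : IsOpen ({0}ᶜ : Set V) := isOpen_compl_singleton
  have hbound : ∀ n ≤ 2, (fun v => ‖iteratedFDeriv ℝ n (fun v => χ v * R v) v‖) =o[𝓝[≠] 0]
      fun v : V => ‖v‖ ^ (2 - n) := by
    intro n hn
    have hsum : (fun v => ∑ i ∈ Finset.range (n + 1), (n.choose i : ℝ) *
        ‖iteratedFDeriv ℝ i χ v‖ * ‖iteratedFDeriv ℝ (n - i) R v‖) =o[𝓝[≠] 0]
        fun v : V => ‖v‖ ^ (2 - n) := by
      refine IsLittleO.fun_sum fun i hi => ?_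
      have hin : i ≤ n := Nat.lt_succ_iff.1 (Finset.mem_range.1 hi)
      have h1 := ((iteratedFDeriv_isBigO_of_homogeneous hχ hom (hin.trans hn)).const_mul_left
        (n.choose i : ℝ)).mul_isLittleO
        ((iteratedFDeriv_isLittleO hR h (j := n - i) (by omega)).mono nhdsWithin_le_nhds)
      refine h1.congr' EventuallyEq.rfl ?_
      filter_upwards [self_mem_nhdsWithin] with v hv
      have : ‖v‖ ≠ 0 := norm_ne_zero_iff.2 hv
      rw [show 2 - (n - i) = i + (2 - n) by omega, pow_add]
      field_simp
    refine IsBigO.trans_isLittleO (IsBigO.of_bound 1 ?_) hsum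
    filter_upwards [self_mem_nhdsWithin] with v hv
    rw [norm_norm, one_mul]
    refine le_trans ?_ (le_abs_self _)
    have := norm_iteratedFDerivWithin_mul_le hχ hR.contDiffOn hopen.uniqueDiffOn hv
      (n := n) (by exact_mod_cast hn)
    simpa only [iteratedFDerivWithin_of_isOpen _ hopen hv] using this
  have h0 : χ 0 * R 0 = 0 := by simp [apply_zero_of_isLittleO two_ne_zero h]
  refine ⟨contDiff_two_of_iteratedFDeriv_isLittleO (hχ.mul hR.contDiffOn) h0 hbound, ?_⟩
  exact isLittleO_nhds_zero_of_punctured h0 (by simpa using hbound 0 (by norm_num))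

end FlatMultiplier

lemma sum_sq_ne_zero {v : Fin 3 → ℝ} (hv : v ≠ 0) : v 0 ^ 2 + v 1 ^ 2 + v 2 ^ 2 ≠ 0 := by
  contrapose! hv
  ext i
  fin_cases i <;> simp <;> nlinarith [sq_nonneg (v 0), sq_nonneg (v 1), sq_nonneg (v 2)]

lemma contDiffOn_mul_div_sum_sq (i j : Fin 3) :
    ContDiffOn ℝ 2 (fun v : Fin 3 → ℝ => v i * v j / (v 0 ^ 2 + v 1 ^ 2 + v 2 ^ 2)) {0}ᶜ :=
  ContDiffOn.div (by fun_prop) (by fun_prop) fun _ hv => sum_sq_ne_zero hv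

lemma mul_div_sum_sq_smul (i j : Fin 3) (c : ℝ) (hc : 0 < c) (v : Fin 3 → ℝ) :
    (c • v) i * (c • v) j / ((c • v) 0 ^ 2 + (c • v) 1 ^ 2 + (c • v) 2 ^ 2) =
      v i * v j / (v 0 ^ 2 + v 1 ^ 2 + v 2 ^ 2) := by
  simp only [Pi.smul_apply, smul_eq_mul]
  rw [show c * v i * (c * v j) = c ^ 2 * (v i * v j) by ring,
    show (c * v 0) ^ 2 + (c * v 1) ^ 2 + (c * v 2) ^ 2 =
      c ^ 2 * (v 0 ^ 2 + v 1 ^ 2 + v 2 ^ 2) by ring,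
    mul_div_mul_left _ _ (by positivity)]

/-- If `x² + y² ∈ I²(E)` and `xz ∈ I²(E)` for a set `E ⊆ ℝ³` containing the origin,
then `x² ∈ I²(E)`. -/
theorem stmt0 (E : Set (Fin 3 → ℝ)) (hE : (0 : Fin 3 → ℝ) ∈ E)
    (h1 : (X 0 ^ 2 + X 1 ^ 2 : MvPolynomial (Fin 3) ℝ) ∈ Im 3 2 E)
    (h2 : (X 0 * X 2 : MvPolynomial (Fin 3) ℝ) ∈ Im 3 2 E) :
    (X 0 ^ 2 : MvPolynomial (Fin 3) ℝ) ∈ Im 3 2 E := by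
  obtain ⟨-, F₁, hF₁, hE₁, ho₁⟩ := h1
  obtain ⟨-, F₂, hF₂, hE₂, ho₂⟩ := h2
  simp only [map_add, map_mul, map_pow, eval_X, Nat.cast_ofNat] at hF₁ hF₂ ho₁ ho₂
  obtain ⟨hC₁, hG₁⟩ := contDiff_two_mul_of_homogeneous (contDiffOn_mul_div_sum_sq 0 0)
    (mul_div_sum_sq_smul 0 0) (hF₁.sub (by fun_prop)) ho₁
  obtain ⟨hC₂, hG₂⟩ := contDiff_two_mul_of_homogeneous (contDiffOn_mul_div_sum_sq 0 2)
    (mul_div_sum_sq_smul 0 2) (hF₂.sub (by fun_prop)) ho₂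
  refine ⟨by simp [totalDegree_X_pow], _,
    ContDiff.add (f := fun v : Fin 3 → ℝ => v 0 ^ 2) (by fun_prop) (hC₁.add hC₂),
    fun v hv => ?_, ?_⟩
  · rcases eq_or_ne v 0 with rfl | hv0
    · simp
    · have := sum_sq_ne_zero hv0
      simp only [hE₁ v hv, hE₂ v hv]
      field_simp
      ring
  · simpa using hG₁.add hG₂
end

section
/- Fix n ≥ 1 and let k ≤ n be a natural number. Let p₁, …, p_k be polynomials on ℝⁿ, all vanishing at the origin, and assume that the k × n Jacobian matrix whose (i,j) entry is ∂p_i/∂x_j(0) has rank k. Then for every m ≥ 1, ⟨p₁, …, p_k⟩_m = I^m(E), where E = {x ∈ ℝⁿ : p₁(x) = ⋯ = p_k(x) = 0} (equivalently E = {x : Σᵢ pᵢ(x)² = 0}). -/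
open MvPolynomial Filter Asymptotics Topology

namespace MvPolynomial

section IdealOfVars

variable {σ : Type*}

theorem pow_idealOfVars_induction {R : Type*} [CommRing R] {C : ℕ → MvPolynomial σ R → Prop}
    (base : ∀ p, C 0 p) (zero : ∀ s, C s 0) (h_add : ∀ s p q, C s p → C s q → C s (p + q))
    (mul : ∀ s j p, p ∈ idealOfVars σ R ^ s → C s p → C (s + 1) (X j * p))
    {s : ℕ} {p : MvPolynomial σ R} (hp : p ∈ idealOfVars σ R ^ s) : C s p := by
  induction s generalizing p with
  | zero => exact base p
  | succ s ih =>
    rw [pow_succ'] at hp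
    refine Submodule.mul_induction_on hp (fun a ha r hr => ?_) fun p q hp hq => h_add _ _ _ hp hq
    induction ha using Submodule.span_induction generalizing r with
    | mem x hx =>
      obtain ⟨j, rfl⟩ := hx
      exact mul s j r hr (ih hr)
    | zero => simpa using zero (s + 1)
    | add x y _ _ hx hy => rw [add_mul]; exact h_add _ _ _ (hx r hr) (hy r hr)
    | smul a x _ hx =>
      rw [smul_eq_mul, mul_comm a x, mul_assoc]
      exact hx _ (Ideal.mul_mem_left _ a hr)

theorem X_mem_idealOfVars {R : Type*} [CommRing R] (j : σ) : X j ∈ idealOfVars σ R :=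
  Ideal.subset_span ⟨j, rfl⟩

theorem sub_C_eval_zero_mem_idealOfVars {R : Type*} [CommRing R] (p : MvPolynomial σ R) :
    p - C (eval 0 p) ∈ idealOfVars σ R := by
  rw [← pow_one (idealOfVars σ R), mem_pow_idealOfVars_iff']
  intro x hx
  obtain rfl : x = 0 := (Finsupp.degree_eq_zero_iff x).mp (by lia)
  simp [← constantCoeff_eq]

theorem sub_linearization_mem_idealOfVars_sq {R : Type*} [CommRing R] [Fintype σ]
    (p : MvPolynomial σ R) :
    p - (C (eval 0 p) + ∑ j, C (eval 0 (pderiv j p)) * X j) ∈ idealOfVars σ R ^ 2 := by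
  classical
  induction p using MvPolynomial.induction_on with
  | C a => simp
  | add p q hp hq =>
    convert! add_mem hp hq using 1
    simp only [map_add, add_mul, Finset.sum_add_distrib]
    ring
  | mul_X p i _ =>
    have h := Ideal.mul_mem_mul (sub_C_eval_zero_mem_idealOfVars p) (X_mem_idealOfVars (R := R) i)
    rw [← sq] at h
    convert! h using 1
    simp [Derivation.leibniz, pderiv_X, Pi.single_apply, sub_mul, apply_ite]

theorem aeval_mem_pow_idealOfVars {R : Type*} [CommRing R] {τ : Type*}
    {P : σ → MvPolynomial τ R} (hP : ∀ j, P j ∈ idealOfVars τ R) {s : ℕ} {r : MvPolynomial σ R}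
    (hr : r ∈ idealOfVars σ R ^ s) : aeval P r ∈ idealOfVars τ R ^ s := by
  refine pow_idealOfVars_induction
    (C := fun s r => aeval P r ∈ idealOfVars τ R ^ s)
    (fun p => ?base) (fun s => ?zero) (fun s p q hp hq => ?add) (fun s j p hp ih => ?mul) hr
  case base => simp
  case zero => simp
  case add => rw [map_add]; exact add_mem hp hq
  case mul =>
    rw [map_mul, aeval_X, pow_succ']
    exact Ideal.mul_mem_mul (hP j) ih

theorem sub_aeval_mem_sup_pow_idealOfVars {R : Type*} [CommRing R] {I : Ideal (MvPolynomial σ R)}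
    {P : σ → MvPolynomial σ R} (hP : ∀ j, P j ∈ idealOfVars σ R)
    (hXP : ∀ j, X j - P j ∈ I ⊔ idealOfVars σ R ^ 2) {s : ℕ} {r : MvPolynomial σ R}
    (hr : r ∈ idealOfVars σ R ^ s) : r - aeval P r ∈ I ⊔ idealOfVars σ R ^ (s + 1) := by
  have mul_mem : ∀ {a b : MvPolynomial σ R} {s t : ℕ}, a ∈ I ⊔ idealOfVars σ R ^ s →
      b ∈ idealOfVars σ R ^ t → a * b ∈ I ⊔ idealOfVars σ R ^ (s + t) := by
    intro a b s t ha hb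
    have h := Ideal.mul_mem_mul ha hb
    rw [Ideal.sup_mul, ← pow_add] at h
    exact sup_le_sup_right (α := Ideal (MvPolynomial σ R)) Ideal.mul_le_left _ h
  refine pow_idealOfVars_induction
    (C := fun s r => r - aeval P r ∈ I ⊔ idealOfVars σ R ^ (s + 1))
    (fun p => ?base) (fun s => ?zero) (fun s p q hp hq => ?add) (fun s j p hp ih => ?mul) hr
  case base =>
    refine Ideal.mem_sup_right ?_
    have h₁ := sub_C_eval_zero_mem_idealOfVars p
    have h₂ := aeval_mem_pow_idealOfVars hP (s := 1) (by simpa using h₁)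
    rw [map_sub, aeval_C, pow_one, algebraMap_eq] at h₂
    simpa using sub_mem h₁ h₂
  case zero => simp
  case add =>
    convert! add_mem hp hq using 1
    simp only [map_add]
    ring
  case mul =>
    have h₁ := mul_mem (hXP j) hp
    have h₂ := mul_mem ih (t := 1) (by simpa using hP j)
    rw [add_comm 2 s] at h₁
    convert! add_mem h₁ h₂ using 1
    simp only [map_mul, aeval_X]
    ring

end IdealOfVars

theorem hasStrictFDerivAt_eval {σ : Type*} [Fintype σ] (p : MvPolynomial σ ℝ) (x : σ → ℝ) :
    HasStrictFDerivAt (fun y => eval y p)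
      (∑ j, eval x (pderiv j p) • ContinuousLinearMap.proj (R := ℝ) (φ := fun _ : σ => ℝ) j) x := by
  classical
  induction p using MvPolynomial.induction_on with
  | C a => simpa using hasStrictFDerivAt_const a x
  | add p q hp hq =>
    convert! hp.add hq using 1
    · ext y; simp
    · simp [add_smul, Finset.sum_add_distrib]
  | mul_X p i hp =>
    convert! hp.mul (hasStrictFDerivAt_apply (𝕜 := ℝ) i x) using 1
    · ext y; simp
    · ext y
      simp [Derivation.leibniz, pderiv_X, Pi.single_apply, add_mul, Finset.sum_add_distrib,
        Finset.mul_sum, apply_ite, mul_assoc]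

theorem contDiff_eval {σ : Type*} [Fintype σ] (p : MvPolynomial σ ℝ) {m : WithTop ℕ∞} :
    ContDiff ℝ m fun y => eval y p :=
  contDiffOn_univ.mp (AnalyticOnNhd.eval_mvPolynomial p).contDiffOn_of_completeSpace

theorem IsHomogeneous.eval_smul {σ R : Type*} [CommSemiring R] {p : MvPolynomial σ R} {s : ℕ}
    (hp : p.IsHomogeneous s) (t : R) (x : σ → R) : eval (t • x) p = t ^ s * eval x p := by
  rw [eval_eq, eval_eq, Finset.mul_sum]
  refine Finset.sum_congr rfl fun d hd => ?_
  simp only [Pi.smul_apply, smul_eq_mul, mul_pow, Finset.prod_mul_distrib]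
  have : ∑ i ∈ d.support, d i = s := by
    simpa [Finsupp.weight_apply, Finsupp.sum] using hp (mem_support_iff.mp hd)
  rw [Finset.prod_pow_eq_pow_sum, this]
  ring

section Asymptotics

variable {σ : Type*} [Fintype σ] {α : Type*} {l : Filter α} {u : α → ℝ}

theorem isBigO_eval_comp {f : α → σ → ℝ} (hf : f =O[l] u) (hf0 : Tendsto f l (𝓝 0)) {s : ℕ}
    {r : MvPolynomial σ ℝ} (hr : r ∈ idealOfVars σ ℝ ^ s) :
    (fun v => eval (f v) r) =O[l] fun v => u v ^ s := by
  refine pow_idealOfVars_induction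
    (C := fun s r => (fun v => eval (f v) r) =O[l] fun v => u v ^ s)
    (fun p => ?base) (fun s => ?zero) (fun s p q hp hq => ?add) (fun s j p hp ih => ?mul) hr
  case base =>
    simpa using (((continuous_eval p).tendsto 0).comp hf0).isBigO_one ℝ
  case zero => simpa using isBigO_zero _ _
  case add => simpa using hp.add hq
  case mul =>
    simpa [pow_succ'] using (isBigO_pi.mp hf j).mul ih

theorem isLittleO_eval_sub_eval {f g : α → σ → ℝ} (hg : g =O[l] u)
    (hfg : (fun v => f v - g v) =o[l] u) (hu : Tendsto u l (𝓝 0)) {s : ℕ}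
    {r : MvPolynomial σ ℝ} (hr : r ∈ idealOfVars σ ℝ ^ s) :
    (fun v => eval (f v) r - eval (g v) r) =o[l] fun v => u v ^ s := by
  have hf : f =O[l] u := by simpa using hfg.isBigO.add hg
  have hf0 := hf.trans_tendsto hu
  have hg0 := hg.trans_tendsto hu
  refine pow_idealOfVars_induction
    (C := fun s r => (fun v => eval (f v) r - eval (g v) r) =o[l] fun v => u v ^ s)
    (fun p => ?base) (fun s => ?zero) (fun s p q hp hq => ?add) (fun s j p hp ih => ?mul) hr
  case base =>
    have h := (((continuous_eval p).tendsto 0).comp hf0).sub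
      (((continuous_eval p).tendsto 0).comp hg0)
    simpa [isLittleO_one_iff] using h
  case zero => simp
  case add =>
    convert! hp.add hq using 2 with v
    simp only [map_add]
    ring
  case mul =>
    have h₁ := (isLittleO_pi.mp hfg j).mul_isBigO (isBigO_eval_comp hf hf0 hp)
    have h₂ := (isBigO_pi.mp hg j).mul_isLittleO ih
    convert! h₁.add h₂ using 2 with v
    · simp only [map_mul, eval_X, Pi.sub_apply]
      ring
    · exact pow_succ' _ _

theorem mem_pow_succ_idealOfVars_of_isLittleO {s : ℕ} {r : MvPolynomial σ ℝ}
    (hr : r ∈ idealOfVars σ ℝ ^ s)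
    (h : (fun v => eval v r) =o[𝓝 (0 : σ → ℝ)] fun v => ‖v‖ ^ s) :
    r ∈ idealOfVars σ ℝ ^ (s + 1) := by
  have hrest : r - homogeneousComponent s r ∈ idealOfVars σ ℝ ^ (s + 1) := by
    rw [mem_pow_idealOfVars_iff'] at hr ⊢
    intro d hd
    rw [coeff_sub, coeff_homogeneousComponent]
    split_ifs with hds
    · simp
    · rw [hr d (by lia), sub_zero]
  have hnorm : (fun v : σ → ℝ => v) =O[𝓝 0] fun v => ‖v‖ := (isBigO_refl _ _).norm_right
  have hlow : (fun v => eval v (homogeneousComponent s r)) =o[𝓝 (0 : σ → ℝ)]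
      fun v => ‖v‖ ^ s := by
    have h₁ : (fun v => eval v (r - homogeneousComponent s r)) =o[𝓝 (0 : σ → ℝ)]
        fun v => ‖v‖ ^ s :=
      (isBigO_eval_comp hnorm tendsto_id hrest).trans_isLittleO
        (isLittleO_norm_pow_norm_pow (Nat.lt_succ_self s))
    simpa using h.sub h₁
  have hzero : homogeneousComponent s r = 0 := by
    refine MvPolynomial.funext fun x => ?_
    have ht : Tendsto (fun t : ℝ => t • x) (𝓝[≠] 0) (𝓝 0) := by
      have : Tendsto (fun t : ℝ => t • x) (𝓝 0) (𝓝 ((0 : ℝ) • x)) :=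
        (continuous_id.smul continuous_const).tendsto 0
      rw [zero_smul] at this
      exact this.mono_left nhdsWithin_le_nhds
    have h₁ := hlow.comp_tendsto ht
    have h₂ : (fun t : ℝ => t ^ s * eval x (homogeneousComponent s r)) =o[𝓝[≠] 0]
        fun t : ℝ => t ^ s * 1 := by
      have h₃ : (fun t : ℝ => ‖t • x‖ ^ s) =O[𝓝[≠] 0] fun t : ℝ => t ^ s * 1 := by
        simp only [norm_smul, mul_pow, mul_one]
        exact IsBigO.of_bound (‖x‖ ^ s) (.of_forall fun t => by
          simp [mul_comm])
      refine IsLittleO.trans_isBigO ?_ h₃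
      refine h₁.congr_left fun t => ?_
      exact (homogeneousComponent_isHomogeneous s r).eval_smul t x
    have h₄ := h₂.tendsto_div_nhds_zero
    have h₅ : (fun t : ℝ => t ^ s * eval x (homogeneousComponent s r) / (t ^ s * 1))
        =ᶠ[𝓝[≠] 0] fun _ => eval x (homogeneousComponent s r) := by
      filter_upwards [self_mem_nhdsWithin] with t ht
      have : t ^ s ≠ 0 := pow_ne_zero _ ht
      field_simp
    rw [map_zero]
    exact tendsto_nhds_unique tendsto_const_nhds (h₄.congr' h₅)
  rwa [hzero, sub_zero] at hrest

end Asymptotics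

end MvPolynomial

theorem HasStrictFDerivAt.exists_isLittleO_of_comp_eq_zero {E F : Type*}
    [NormedAddCommGroup E] [NormedSpace ℝ E] [FiniteDimensional ℝ E]
    [NormedAddCommGroup F] [NormedSpace ℝ F] [FiniteDimensional ℝ F]
    {f : E → F} {D : E →L[ℝ] F} (hf : HasStrictFDerivAt f D 0) (hD : D.range = ⊤)
    (hf0 : f 0 = 0) (G : E →L[ℝ] E) (hG : ∀ x, D (G x) = 0) :
    ∃ ψ : E → E, (∀ᶠ x in 𝓝 0, f (ψ x) = 0) ∧ (fun x => ψ x - G x) =o[𝓝 0] fun x => x := by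
  have := FiniteDimensional.complete ℝ E
  have := FiniteDimensional.complete ℝ F
  let H : E →L[ℝ] D.ker := G.codRestrict D.ker fun x => hG x
  have hH : Tendsto H (𝓝 0) (𝓝 0) := by simpa using H.continuous.tendsto 0
  refine ⟨fun x => hf.implicitFunction f D hD (f 0) (H x), ?_, ?_⟩
  · have h := (tendsto_const_nhds (x := f 0)).prodMk_nhds hH |>.eventually
      (hf.map_implicitFunction_eq hD)
    filter_upwards [h] with x hx
    exact hx.trans hf0
  · have h := ((hf.to_implicitFunction hD).hasFDerivAt.isLittleO.comp_tendsto hH).trans_isBigO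
      (k := fun x : E => x) (by simpa [Function.comp_def] using H.isBigO_id (𝓝 0))
    refine h.congr_left fun x => ?_
    have hHx : (H x : E) = G x := rfl
    simp [hHx]

theorem Matrix.exists_mul_eq_one_of_rank_eq {K : Type*} [Field K] {k n : ℕ}
    {A : Matrix (Fin k) (Fin n) K} (hA : A.rank = k) : ∃ B : Matrix (Fin n) (Fin k) K, A * B = 1 := by
  rw [← Matrix.mulVec_surjective_iff_exists_right_inverse]
  have : A.mulVecLin.range = ⊤ := Submodule.eq_top_of_finrank_eq (by simpa [Matrix.rank] using hA)
  exact LinearMap.range_eq_top.mp this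

theorem truncIdeal_eq {n m : ℕ} {ι : Type} [Fintype ι] (ps : ι → MvPolynomial (Fin n) ℝ) :
    truncIdeal n m ps =
      {p | p.totalDegree ≤ m ∧ p ∈ Ideal.span (Set.range ps) ⊔ idealOfVars (Fin n) ℝ ^ (m + 1)} := by
  have key (p : MvPolynomial (Fin n) ℝ) : (∃ q : ι → MvPolynomial (Fin n) ℝ,
      p - ∑ i, q i * ps i ∈ idealOfVars (Fin n) ℝ ^ (m + 1)) ↔
      p ∈ Ideal.span (Set.range ps) ⊔ idealOfVars (Fin n) ℝ ^ (m + 1) := by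
    rw [Submodule.mem_sup]
    constructor
    · rintro ⟨q, hq⟩
      exact ⟨_, Ideal.mem_span_range_iff_exists_fun.mpr ⟨q, rfl⟩, _, hq, by ring⟩
    · rintro ⟨y, hy, z, hz, rfl⟩
      obtain ⟨q, rfl⟩ := Ideal.mem_span_range_iff_exists_fun.mp hy
      exact ⟨q, by simpa using hz⟩
  ext p
  simp only [Set.mem_ofPred_eq, ← key, mem_pow_idealOfVars_iff', truncIdeal, Nat.lt_succ_iff]
  rfl

theorem truncIdeal_subset_Im {n m : ℕ} {ι : Type} [Fintype ι]
    (ps : ι → MvPolynomial (Fin n) ℝ) :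
    truncIdeal n m ps ⊆ Im n m {x : Fin n → ℝ | ∀ i, eval x (ps i) = 0} := by
  rw [truncIdeal_eq]
  rintro p ⟨hdeg, hp⟩
  obtain ⟨y, hy, z, hz, rfl⟩ := Submodule.mem_sup.mp hp
  obtain ⟨q, rfl⟩ := Ideal.mem_span_range_iff_exists_fun.mp hy
  refine ⟨hdeg, fun v => eval v (∑ i, q i * ps i), contDiff_eval _, fun x hx => ?_, ?_⟩
  · simp only [map_sum, map_mul]
    exact Finset.sum_eq_zero fun i _ => by rw [hx i, mul_zero]
  · have h := (isBigO_eval_comp (l := 𝓝 (0 : Fin n → ℝ)) (f := fun v => v)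
      (isBigO_refl _ _).norm_right tendsto_id hz).trans_isLittleO
        (isLittleO_norm_pow_norm_pow (Nat.lt_succ_self m))
    simpa using h.neg_left

/-- If `p₁,…,p_k` vanish at the origin and their Jacobian matrix at the origin has rank `k`,
then for every `m ≥ 1`, `⟨p₁,…,p_k⟩_m = I^m({p₁ = ⋯ = p_k = 0})`. -/
theorem stmt2 (n k : ℕ) (hn : 1 ≤ n) (hk : k ≤ n)
    (ps : Fin k → MvPolynomial (Fin n) ℝ)
    (h0 : ∀ i, eval (0 : Fin n → ℝ) (ps i) = 0)
    (hrank : (Matrix.of fun (i : Fin k) (j : Fin n) =>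
        eval (0 : Fin n → ℝ) (pderiv j (ps i))).rank = k) :
    ∀ m : ℕ, 1 ≤ m →
      truncIdeal n m ps = Im n m {x : Fin n → ℝ | ∀ i, eval x (ps i) = 0} := by
  intro m _
  refine (truncIdeal_subset_Im ps).antisymm ?_
  rintro p ⟨hdeg, F, -, hFE, hFp⟩
  rw [truncIdeal_eq]
  refine ⟨hdeg, ?_⟩
  set A : Matrix (Fin k) (Fin n) ℝ :=
    Matrix.of fun i j => eval (0 : Fin n → ℝ) (pderiv j (ps i))
  obtain ⟨B, hAB⟩ := Matrix.exists_mul_eq_one_of_rank_eq hrank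
  let L : Fin k → MvPolynomial (Fin n) ℝ := fun i => ∑ j, C (A i j) * X j
  let P : Fin n → MvPolynomial (Fin n) ℝ := fun j => X j - ∑ i, C (B j i) * L i
  have hL (i) : L i ∈ idealOfVars (Fin n) ℝ :=
    sum_mem fun j _ => Ideal.mul_mem_left _ _ (X_mem_idealOfVars j)
  have hP (j) : P j ∈ idealOfVars (Fin n) ℝ :=
    sub_mem (X_mem_idealOfVars j) (sum_mem fun i _ => Ideal.mul_mem_left _ _ (hL i))
  have hXP (j) : X j - P j ∈ Ideal.span (Set.range ps) ⊔ idealOfVars (Fin n) ℝ ^ 2 := by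
    simp only [P, sub_sub_cancel]
    refine sum_mem fun i _ => Ideal.mul_mem_left _ _ ?_
    have h := sub_linearization_mem_idealOfVars_sq (ps i)
    rw [h0, map_zero, zero_add] at h
    have hi : ps i ∈ Ideal.span (Set.range ps) := Ideal.subset_span (Set.mem_range_self i)
    simpa only [sub_sub_cancel, L, A, Matrix.of_apply] using sub_mem
      (Ideal.mem_sup_left hi : ps i ∈ Ideal.span (Set.range ps) ⊔ idealOfVars (Fin n) ℝ ^ 2)
      (Ideal.mem_sup_right h)
  let D : (Fin n → ℝ) →L[ℝ] (Fin k → ℝ) := A.mulVecLin.toContinuousLinearMap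
  let G : (Fin n → ℝ) →L[ℝ] (Fin n → ℝ) := (1 - B * A).mulVecLin.toContinuousLinearMap
  have hD : HasStrictFDerivAt (fun x i => eval x (ps i)) D 0 := by
    rw [hasStrictFDerivAt_pi']
    intro i
    convert! hasStrictFDerivAt_eval (ps i) 0 using 1
    ext x
    simp [D, A, Matrix.mulVec, dotProduct]
  have hDsurj : D.range = ⊤ := by
    refine LinearMap.range_eq_top.mpr ?_
    exact Matrix.mulVec_surjective_iff_exists_right_inverse.mpr ⟨B, hAB⟩
  have hDG (x) : D (G x) = 0 := by
    simp [D, G, Matrix.mulVec_sub, ← Matrix.mul_assoc, hAB]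
  have hPG (x : Fin n → ℝ) (r : MvPolynomial (Fin n) ℝ) : eval x (aeval P r) = eval (G x) r := by
    have hx : (fun j => eval x (P j)) = G x := by
      ext j
      have hGx : G x = x - B.mulVec (A.mulVec x) := by
        simp [G]
      simp [hGx, P, L, -Matrix.mulVec_mulVec, Matrix.mulVec, dotProduct]
    rw [← hx, aeval_def, eval_eval₂]
    simp [eval₂_eq', eval_eq', algebraMap_eq]
  obtain ⟨ψ, hψE, hψ⟩ := hD.exists_isLittleO_of_comp_eq_zero hDsurj (funext h0) G hDG
  have hψE' : ∀ᶠ x in 𝓝 0, ∀ i, eval (ψ x) (ps i) = 0 := hψE.mono fun x hx => congrFun hx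
  have hψG : (fun x => ψ x - G x) =o[𝓝 0] fun x => ‖x‖ := hψ.norm_right
  have hGO : G =O[𝓝 0] fun x => ‖x‖ := (G.isBigO_id _).norm_right
  have hψO : ψ =O[𝓝 0] fun x => ‖x‖ := by simpa using hψG.isBigO.add hGO
  have hψ0 : Tendsto ψ (𝓝 0) (𝓝 0) := hψO.trans_tendsto tendsto_norm_zero
  have hpψ : (fun x => eval (ψ x) p) =o[𝓝 0] fun x => ‖x‖ ^ m := by
    have h := ((hFp.comp_tendsto hψ0).trans_isBigO (hψO.norm_left.pow m)).neg_left
    refine h.congr' ?_ .rfl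
    filter_upwards [hψE'] with x hx
    simp [hFE _ hx]
  suffices ∀ s ≤ m + 1, p ∈ Ideal.span (Set.range ps) ⊔ idealOfVars (Fin n) ℝ ^ s from
    this _ le_rfl
  intro s hs
  induction s with
  | zero => simp
  | succ s ih =>
    obtain ⟨y, hy, r, hr, rfl⟩ := Submodule.mem_sup.mp (ih (by lia))
    refine add_mem (Ideal.mem_sup_left hy) ?_
    obtain ⟨q, rfl⟩ := Ideal.mem_span_range_iff_exists_fun.mp hy
    have hrψ : (fun x => eval (ψ x) r) =o[𝓝 0] fun x => ‖x‖ ^ s := by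
      have hms : (fun x : Fin n → ℝ => ‖x‖ ^ m) =O[𝓝 0] fun x => ‖x‖ ^ s := by
        rcases (show s ≤ m by lia).eq_or_lt with rfl | hlt
        · exact isBigO_refl _ _
        · exact (isLittleO_norm_pow_norm_pow hlt).isBigO
      refine (hpψ.trans_isBigO hms).congr' ?_ .rfl
      filter_upwards [hψE'] with x hx
      simp [hx]
    have hrP : aeval P r ∈ idealOfVars (Fin n) ℝ ^ (s + 1) := by
      refine mem_pow_succ_idealOfVars_of_isLittleO (aeval_mem_pow_idealOfVars hP hr) ?_
      simp only [hPG]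
      simpa using hrψ.sub (isLittleO_eval_sub_eval hGO hψG tendsto_norm_zero hr)
    have h := sub_aeval_mem_sup_pow_idealOfVars hP hXP hr
    simpa using add_mem h (Ideal.mem_sup_right hrP)
end

section
/- Fix n ≥ 1 and let p be a polynomial on ℝⁿ with p(0) = 0 whose gradient at the origin is nonzero (i.e., p has order of vanishing 1 at the origin). Then for every m ≥ 1, ⟨p⟩_m = I^m({x ∈ ℝⁿ : p(x) = 0}). -/
open MvPolynomial Filter Asymptotics Topology

theorem MvPolynomial.mem_pow_idealOfVars_succ_iff {n m : ℕ} {f : MvPolynomial (Fin n) ℝ} :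
    f ∈ idealOfVars (Fin n) ℝ ^ (m + 1) ↔
      ∀ d : Fin n →₀ ℕ, (d.sum fun _ e => e) ≤ m → coeff d f = 0 := by
  rw [mem_pow_idealOfVars_iff']
  refine forall_congr' fun d => ?_
  rw [Nat.lt_succ_iff]
  rfl

/-- A polynomial is congruent to its linear part modulo the square of the ideal of the origin. -/
theorem MvPolynomial.sub_linearPart_mem_sq_idealOfVars {n : ℕ} {p : MvPolynomial (Fin n) ℝ}
    (hp : constantCoeff p = 0) :
    p - ∑ i, C (coeff (Finsupp.single i 1) p) * X i ∈ idealOfVars (Fin n) ℝ ^ 2 := by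
  rw [mem_pow_idealOfVars_iff']
  intro d hd
  have hd' : d.degree = 0 ∨ d.degree = 1 := by omega
  rcases hd' with h | h
  · rw [Finsupp.degree_eq_zero_iff] at h
    subst h
    simpa [coeff_sum, coeff_C_mul, ← constantCoeff_eq] using hp
  · obtain ⟨i, rfl⟩ : ∃ i, d = Finsupp.single i 1 := by
      have := (Finsupp.sum_eq_one_iff d).1 h
      exact this
    simp [coeff_sum, coeff_C_mul, coeff_X, Finsupp.single_left_inj]

/-- A polynomial all of whose monomials have degree greater than `m` is `o(‖v‖ ^ m)` at `0`. -/
theorem MvPolynomial.isLittleO_eval_of_mem_pow_idealOfVars {n m : ℕ}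
    {f : MvPolynomial (Fin n) ℝ} (hf : f ∈ idealOfVars (Fin n) ℝ ^ (m + 1)) :
    (fun v => eval v f) =o[𝓝 (0 : Fin n → ℝ)] (fun v => ‖v‖ ^ m) := by
  rw [mem_pow_idealOfVars_succ_iff] at hf
  simp_rw [eval_eq']
  refine IsLittleO.fun_sum fun d hd => IsLittleO.const_mul_left ?_ _
  have hdm : m + 1 ≤ ∑ i, d i := by
    by_contra! h
    refine mem_support_iff.1 hd (hf d ?_)
    rw [Finsupp.sum_fintype _ _ (by simp)]
    omega
  have hb : (fun v : Fin n → ℝ => ∏ i, v i ^ d i) =O[𝓝 0] (fun v => ‖v‖ ^ (∑ i, d i)) := by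
    refine IsBigO.of_bound 1 (Eventually.of_forall fun v => ?_)
    rw [← Finset.prod_pow_eq_pow_sum, norm_prod, norm_prod, one_mul]
    refine Finset.prod_le_prod (fun _ _ => norm_nonneg _) fun i _ => ?_
    rw [norm_pow, norm_pow, norm_norm]
    gcongr
    exact norm_le_pi_norm v i
  refine hb.trans_isLittleO ?_
  have h := (isLittleO_pow_pow (𝕜 := ℝ) (by omega : m < ∑ i, d i)).comp_tendsto
    (tendsto_norm_zero (E := Fin n → ℝ))
  exact h

/-- If a subalgebra `S` contains the variables modulo the square of the ideal of the origin, then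
it contains every polynomial modulo any power of that ideal. -/
theorem MvPolynomial.exists_sub_mem_pow_idealOfVars {n : ℕ}
    {S : Subalgebra ℝ (MvPolynomial (Fin n) ℝ)}
    (hX : ∀ i, ∃ s ∈ S, X i - s ∈ idealOfVars (Fin n) ℝ ^ 2) (k : ℕ)
    (f : MvPolynomial (Fin n) ℝ) :
    ∃ s ∈ S, f - s ∈ idealOfVars (Fin n) ℝ ^ k := by
  set I := idealOfVars (Fin n) ℝ with hI
  have hconst : ∀ g : MvPolynomial (Fin n) ℝ, g - C (constantCoeff g) ∈ I := by
    intro g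
    rw [← pow_one I, hI, mem_pow_idealOfVars_iff']
    intro d hd
    obtain rfl : d = 0 := (Finsupp.degree_eq_zero_iff d).1 (by omega)
    simp [constantCoeff_eq]
  have hC : ∀ c : ℝ, (C c : MvPolynomial (Fin n) ℝ) ∈ S := fun c => S.algebraMap_mem c
  have hone : ∀ f ∈ I, ∃ s ∈ S, s ∈ I ∧ f - s ∈ I ^ 2 := by
    intro f hf
    refine Submodule.span_induction ?_ ?_ ?_ ?_ hf
    · rintro _ ⟨i, rfl⟩
      obtain ⟨s, hs, h⟩ := hX i
      refine ⟨s, hs, ?_, h⟩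
      have hXi : (X i : MvPolynomial (Fin n) ℝ) ∈ I := Ideal.subset_span ⟨i, rfl⟩
      have := I.sub_mem hXi (Ideal.pow_le_self two_ne_zero h)
      rwa [sub_sub_cancel] at this
    · exact ⟨0, S.zero_mem, I.zero_mem, by simp⟩
    · rintro f g - - ⟨s, hs, hsI, h⟩ ⟨t, ht, htI, h'⟩
      refine ⟨s + t, S.add_mem hs ht, I.add_mem hsI htI, ?_⟩
      rw [add_sub_add_comm]
      exact Ideal.add_mem _ h h'
    · rintro g f hf ⟨s, hs, hsI, h⟩
      refine ⟨C (constantCoeff g) * s, S.mul_mem (hC _) hs, I.mul_mem_left _ hsI, ?_⟩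
      have e : g • f - C (constantCoeff g) * s =
          (g - C (constantCoeff g)) * f + C (constantCoeff g) * (f - s) := by
        rw [smul_eq_mul]; ring
      rw [e]
      refine Ideal.add_mem _ ?_ (Ideal.mul_mem_left _ _ h)
      rw [pow_two]
      exact Ideal.mul_mem_mul (hconst g) hf
  have hstep : ∀ k, ∀ f ∈ I ^ k, ∃ s ∈ S, s ∈ I ^ k ∧ f - s ∈ I ^ (k + 1) := by
    intro k
    induction k with
    | zero =>
      intro f _
      exact ⟨C (constantCoeff f), hC _, by simp, by simpa using hconst f⟩
    | succ k ih =>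
      intro f hf
      rw [pow_succ] at hf
      refine Submodule.mul_induction_on hf ?_ ?_
      · intro f hf g hg
        obtain ⟨s, hs, hsI, h⟩ := ih f hf
        obtain ⟨t, ht, htI, h'⟩ := hone g hg
        refine ⟨s * t, S.mul_mem hs ht, pow_succ I k ▸ Ideal.mul_mem_mul hsI htI, ?_⟩
        have e : f * g - s * t = (f - s) * g + s * (g - t) := by ring
        rw [e]
        refine Ideal.add_mem _ ?_ ?_
        · rw [pow_succ]
          exact Ideal.mul_mem_mul h hg
        · rw [add_assoc, pow_add]
          exact Ideal.mul_mem_mul hsI h'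
      · rintro f g ⟨s, hs, hsI, h⟩ ⟨t, ht, htI, h'⟩
        refine ⟨s + t, S.add_mem hs ht, Ideal.add_mem _ hsI htI, ?_⟩
        rw [add_sub_add_comm]
        exact Ideal.add_mem _ h h'
  induction k with
  | zero => exact ⟨0, S.zero_mem, by simp⟩
  | succ k ih =>
    obtain ⟨s, hs, h⟩ := ih
    obtain ⟨t, ht, -, h'⟩ := hstep k _ h
    exact ⟨s + t, S.add_mem hs ht, by rwa [← sub_sub]⟩

/-- If `p` has a nonzero `X j` coefficient and no constant term, then every polynomial is, modulo
`p` and terms of high order, a polynomial not involving `X j`. -/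
theorem MvPolynomial.exists_sub_mul_sub_mem_pow_idealOfVars {n : ℕ}
    {p : MvPolynomial (Fin n) ℝ} (hp : constantCoeff p = 0) {j : Fin n}
    (hj : coeff (Finsupp.single j 1) p ≠ 0) (k : ℕ) (f : MvPolynomial (Fin n) ℝ) :
    ∃ q, ∃ s ∈ supported ℝ ({j}ᶜ : Set (Fin n)), f - q * p - s ∈ idealOfVars (Fin n) ℝ ^ k := by
  set T := supported ℝ ({j}ᶜ : Set (Fin n)) with hT
  set π := Ideal.Quotient.mkₐ ℝ (Ideal.span {p}) with hπ
  set S := (T.map π).comap π with hS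
  have hTS : ∀ s ∈ T, s ∈ S := fun s hs => ⟨s, hs, rfl⟩
  have hpS : p ∈ S := by
    refine ⟨0, T.zero_mem, ?_⟩
    simp only [map_zero, RingHom.coe_coe]
    exact (Ideal.Quotient.eq_zero_iff_mem.2 (Ideal.mem_span_singleton_self p)).symm
  have hXT : ∀ i ≠ j, (X i : MvPolynomial (Fin n) ℝ) ∈ T := fun i hi =>
    X_mem_supported.2 (by simpa using hi)
  have hX : ∀ i, ∃ s ∈ S, X i - s ∈ idealOfVars (Fin n) ℝ ^ 2 := by
    intro i
    by_cases hij : i = j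
    · subst hij
      set a := coeff (Finsupp.single i 1) p with ha
      set L := ∑ l ∈ Finset.univ.erase i, C (coeff (Finsupp.single l 1) p) * X l with hL
      refine ⟨C a⁻¹ * (p - L), S.mul_mem (S.algebraMap_mem _) (S.sub_mem hpS (hTS _ ?_)), ?_⟩
      · exact T.sum_mem fun l hl =>
          T.mul_mem (T.algebraMap_mem _) (hXT l (Finset.ne_of_mem_erase hl))
      · have h := sub_linearPart_mem_sq_idealOfVars hp
        rw [← Finset.add_sum_erase _ _ (Finset.mem_univ i), ← hL, ← ha] at h
        have hC : (C a⁻¹ * C a : MvPolynomial (Fin n) ℝ) = 1 := by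
          rw [← C_mul, inv_mul_cancel₀ hj, C_1]
        have e : X i - C a⁻¹ * (p - L) = -C a⁻¹ * (p - (C a * X i + L)) := by
          linear_combination (-X i) * hC
        rw [e]
        exact Ideal.mul_mem_left _ _ h
    · exact ⟨X i, hTS _ (hXT i hij), by simp⟩
  obtain ⟨s, hs, h⟩ := exists_sub_mem_pow_idealOfVars hX k f
  obtain ⟨t, ht, hts⟩ := hs
  have hst : s - t ∈ Ideal.span {p} := Ideal.Quotient.eq.1 hts.symm
  obtain ⟨q, hq⟩ := Ideal.mem_span_singleton'.1 hst
  refine ⟨q, t, ht, ?_⟩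
  rwa [hq, sub_sub, sub_add_cancel]

/-- A polynomial in one variable of degree at most `m` which is `o(τ ^ m)` is zero. -/
theorem eq_zero_of_sum_pow_isLittleO {m : ℕ} {a : ℕ → ℝ}
    (h : (fun τ : ℝ => ∑ k ∈ Finset.range (m + 1), a k * τ ^ k) =o[𝓝[>] 0] fun τ => τ ^ m) :
    ∀ k ≤ m, a k = 0 := by
  have key : ∀ (c : ℝ) (k : ℕ),
      (fun τ : ℝ => c * τ ^ k) =o[𝓝[>] 0] (fun τ => τ ^ k) → c = 0 := by
    intro c k hc
    by_contra hne
    have h1 := (isLittleO_const_mul_left_iff hne).1 hc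
    have h2 := isLittleO_irrefl' (l := 𝓝[>] (0 : ℝ)) (f' := fun τ : ℝ => τ ^ k) ?_ h1
    · exact h2
    · refine Eventually.frequently ?_
      filter_upwards [self_mem_nhdsWithin] with τ hτ
      exact norm_ne_zero_iff.2 (pow_ne_zero _ (ne_of_gt hτ))
  induction m with
  | zero =>
    intro k hk
    obtain rfl : k = 0 := by omega
    refine key _ 0 ?_
    simpa using h
  | succ m ih =>
    simp_rw [Finset.sum_range_succ _ (m + 1)] at h
    have hpow : (fun τ : ℝ => τ ^ (m + 1)) =o[𝓝[>] 0] fun τ => τ ^ m :=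
      (isLittleO_pow_pow (Nat.lt_succ_self m)).mono nhdsWithin_le_nhds
    have h1 := ih (by simpa using (h.trans hpow).sub (hpow.const_mul_left (a (m + 1))))
    intro k hk
    rcases hk.lt_or_eq with hk | rfl
    · exact h1 k (by omega)
    · refine key _ _ (h.congr_left fun τ => ?_)
      rw [Finset.sum_eq_zero, zero_add]
      intro i hi
      rw [h1 i (by simpa [Nat.lt_succ_iff] using hi), zero_mul]

/-- The sign of a polynomial vanishing at the origin on a short initial piece of a ray is given by
its linear part. -/
theorem MvPolynomial.eventually_eval_smul_pos {n : ℕ} {p : MvPolynomial (Fin n) ℝ}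
    (hp : constantCoeff p = 0) {w : Fin n → ℝ}
    (hw : 0 < ∑ i, coeff (Finsupp.single i 1) p * w i) :
    ∀ᶠ τ in 𝓝[>] (0 : ℝ), 0 < eval (τ • w) p := by
  set c := ∑ i, coeff (Finsupp.single i 1) p * w i with hc
  have h := isLittleO_eval_of_mem_pow_idealOfVars (m := 1) (sub_linearPart_mem_sq_idealOfVars hp)
  have ht : Tendsto (fun τ : ℝ => τ • w) (𝓝[>] 0) (𝓝 0) := by
    have : Tendsto (fun τ : ℝ => τ • w) (𝓝 0) (𝓝 ((0 : ℝ) • w)) :=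
      (continuous_id.smul continuous_const).tendsto 0
    rw [zero_smul] at this
    exact this.mono_left nhdsWithin_le_nhds
  have h1 := (h.comp_tendsto ht).def (c := c / (2 * (‖w‖ + 1))) (by positivity)
  filter_upwards [h1, self_mem_nhdsWithin] with τ h2 hτ
  have hτ : 0 < τ := hτ
  have hlin : ∑ i, coeff (Finsupp.single i 1) p * (τ * w i) = τ * c := by
    rw [hc, Finset.mul_sum]
    exact Finset.sum_congr rfl fun i _ => by ring
  simp only [Function.comp_apply, map_sub, map_sum, map_mul, eval_C, eval_X, Pi.smul_apply,
    smul_eq_mul, hlin, pow_one, norm_smul, Real.norm_eq_abs, abs_mul, abs_of_pos hτ, abs_norm] at h2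
  have h3 : c / (2 * (‖w‖ + 1)) * (τ * ‖w‖) ≤ τ * c / 2 := by
    rw [div_mul_eq_mul_div, div_le_div_iff₀ (by positivity) (by positivity)]
    nlinarith [mul_pos hτ hw]
  have h4 := (abs_le.1 h2).1
  nlinarith [mul_pos hτ hw]

/-- If `p` vanishes at the origin and its `j`-th partial derivative there does not, the zero set
of `p` meets the `j`-direction over `τ • v` at a distance `O(τ)` as `τ → 0+`. -/
theorem MvPolynomial.exists_root_near_line {n : ℕ} {p : MvPolynomial (Fin n) ℝ}
    (hp : constantCoeff p = 0) {j : Fin n} (hj : coeff (Finsupp.single j 1) p ≠ 0)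
    (v : Fin n → ℝ) :
    ∃ K : ℝ, ∀ᶠ τ in 𝓝[>] (0 : ℝ), ∃ w : Fin n → ℝ, eval w p = 0 ∧ ‖w‖ ≤ K * τ ∧
      ∀ i ≠ j, w i = τ * v i := by
  set a := coeff (Finsupp.single j 1) p with ha
  set c := ∑ i, coeff (Finsupp.single i 1) p * v i with hc
  set D := (|c| + 1) / a with hD
  have hlin : ∀ t : ℝ, ∑ i, coeff (Finsupp.single i 1) p * (v + t • (Pi.single j D : Fin n → ℝ)) i =
      c + t * (|c| + 1) := by
    intro t
    simp only [Pi.add_apply, Pi.smul_apply, smul_eq_mul, mul_add, Finset.sum_add_distrib, ← hc]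
    rw [Finset.sum_eq_single j (fun i _ hi => by simp [Pi.single_eq_of_ne hi]) (by simp),
      Pi.single_eq_same, ← ha, hD]
    field_simp
  have hpos := eventually_eval_smul_pos hp (w := v + (1 : ℝ) • Pi.single j D)
    (by rw [hlin]; linarith [neg_abs_le c])
  have hneg := eventually_eval_smul_pos (p := -p) (by simpa using hp)
    (w := v + (-1 : ℝ) • Pi.single j D) (by
      simp only [coeff_neg, neg_mul, Finset.sum_neg_distrib]
      rw [hlin]; linarith [le_abs_self c])
  refine ⟨‖v‖ + |D|, ?_⟩
  filter_upwards [hpos, hneg, self_mem_nhdsWithin] with τ h1 h2 hτ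
  have hτ : 0 < τ := hτ
  rw [map_neg, neg_pos] at h2
  have hcont : Continuous fun t : ℝ => eval (τ • (v + t • Pi.single j D)) p :=
    (MvPolynomial.continuous_eval p).comp (by fun_prop)
  obtain ⟨t, ht, h0⟩ := intermediate_value_Icc (by norm_num : (-1 : ℝ) ≤ 1)
    hcont.continuousOn ⟨h2.le, h1.le⟩
  refine ⟨_, h0, ?_, fun i hi => by simp [Pi.single_eq_of_ne hi]⟩
  rw [norm_smul, Real.norm_eq_abs, abs_of_pos hτ, mul_comm]
  gcongr
  refine (norm_add_le _ _).trans ?_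
  gcongr
  rw [norm_smul, Pi.norm_single, Real.norm_eq_abs, Real.norm_eq_abs]
  exact mul_le_of_le_one_left (abs_nonneg _) (abs_le.2 ht)

/-- Restriction of a little-o estimate at the origin to a curve of size `O(τ)`. -/
theorem isLittleO_along {n m : ℕ} {g : (Fin n → ℝ) → ℝ} {w : ℝ → Fin n → ℝ} {K : ℝ}
    (hg : g =o[𝓝 0] fun v => ‖v‖ ^ m) (hw : ∀ᶠ τ in 𝓝[>] (0 : ℝ), ‖w τ‖ ≤ K * τ) :
    (fun τ => g (w τ)) =o[𝓝[>] 0] fun τ => τ ^ m := by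
  have hO : w =O[𝓝[>] 0] fun τ : ℝ => τ := by
    refine IsBigO.of_bound K ?_
    filter_upwards [hw, self_mem_nhdsWithin] with τ h hτ
    rwa [Real.norm_eq_abs, abs_of_pos hτ]
  have ht : Tendsto w (𝓝[>] 0) (𝓝 0) :=
    hO.trans_tendsto (tendsto_id.mono_left nhdsWithin_le_nhds)
  exact (hg.comp_tendsto ht).trans_isBigO (hO.norm_left.pow m)

theorem MvPolynomial.IsHomogeneous.eval_smul_eq {n k : ℕ} {f : MvPolynomial (Fin n) ℝ}
    (hf : f.IsHomogeneous k) (τ : ℝ) (v : Fin n → ℝ) : eval (τ • v) f = τ ^ k * eval v f := by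
  simp_rw [eval_eq', Finset.mul_sum, Pi.smul_apply, smul_eq_mul, mul_pow,
    Finset.prod_mul_distrib, Finset.prod_pow_eq_pow_sum]
  refine Finset.sum_congr rfl fun d hd => ?_
  have hd : d.degree = k := by
    by_contra hne
    exact mem_support_iff.1 hd (hf.coeff_eq_zero hne)
  rw [← Finsupp.degree_eq_sum, hd]
  ring

/-- A polynomial which is `o(τ ^ m)` along every ray from the origin has no monomial of degree at
most `m`. -/
theorem MvPolynomial.mem_pow_idealOfVars_of_isLittleO {n m : ℕ} {s : MvPolynomial (Fin n) ℝ}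
    (h : ∀ v : Fin n → ℝ, (fun τ : ℝ => eval (τ • v) s) =o[𝓝[>] 0] fun τ => τ ^ m) :
    s ∈ idealOfVars (Fin n) ℝ ^ (m + 1) := by
  have hcomp : ∀ k ≤ m, homogeneousComponent k s = 0 := by
    suffices ∀ v : Fin n → ℝ, ∀ k ≤ m, eval v (homogeneousComponent k s) = 0 from
      fun k hk => MvPolynomial.funext fun v => by rw [this v k hk, map_zero]
    intro v
    refine eq_zero_of_sum_pow_isLittleO ?_
    have hmem : s - ∑ k ∈ Finset.range (m + 1), homogeneousComponent k s ∈
        idealOfVars (Fin n) ℝ ^ (m + 1) := by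
      rw [mem_pow_idealOfVars_iff']
      intro d hd
      simp [coeff_sum, coeff_homogeneousComponent, hd]
    have ho := isLittleO_eval_of_mem_pow_idealOfVars hmem
    have hr := isLittleO_along (w := fun τ : ℝ => τ • v) (K := ‖v‖) ho (by
      filter_upwards [self_mem_nhdsWithin] with τ hτ
      rw [norm_smul, Real.norm_eq_abs, abs_of_pos hτ, mul_comm])
    refine ((h v).sub hr).congr_left fun τ => ?_
    simp only [map_sub, map_sum, sub_sub_cancel]
    refine Finset.sum_congr rfl fun k _ => ?_
    rw [(homogeneousComponent_isHomogeneous k s).eval_smul_eq, mul_comm]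
  rw [mem_pow_idealOfVars_iff']
  intro d hd
  have := congrArg (coeff d) (hcomp d.degree (by omega))
  simpa [coeff_homogeneousComponent] using this

/-- If `p(0) = 0` and the gradient of `p` at the origin is nonzero, then for every `m ≥ 1`
one has `⟨p⟩_m = I^m({p = 0})`. -/
theorem stmt3 (n : ℕ) (hn : 1 ≤ n) (p : MvPolynomial (Fin n) ℝ)
    (h0 : eval (0 : Fin n → ℝ) p = 0)
    (hgrad : ∃ j : Fin n, eval (0 : Fin n → ℝ) (pderiv j p) ≠ 0) :
    ∀ m : ℕ, 1 ≤ m →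
      truncIdeal n m (fun _ : Fin 1 => p) = Im n m {x : Fin n → ℝ | eval x p = 0} := by
  intro m _
  obtain ⟨j, hj⟩ := hgrad
  have hp : constantCoeff p = 0 := by rwa [← eval_zero]
  have hj : coeff (Finsupp.single j 1) p ≠ 0 := by
    rw [eval_zero, constantCoeff_eq, coeff_pderiv] at hj
    simpa using hj
  ext r
  refine and_congr_right fun _ => ⟨?_, ?_⟩
  · rintro ⟨q, hq⟩
    rw [← mem_pow_idealOfVars_succ_iff, Fin.sum_univ_one] at hq
    refine ⟨fun v => eval v (q 0 * p), ?_, fun x hx => ?_, ?_⟩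
    · exact (AnalyticOnNhd.eval_mvPolynomial _).contDiff
    · have hx : eval x p = 0 := hx
      simp [hx]
    · refine (isLittleO_eval_of_mem_pow_idealOfVars hq).neg_left.congr_left fun v => ?_
      rw [map_sub, neg_sub]
  · rintro ⟨F, -, hF, hFr⟩
    obtain ⟨q, s, hs, hqs⟩ := exists_sub_mul_sub_mem_pow_idealOfVars hp hj (m + 1) r
    refine ⟨fun _ => q, ?_⟩
    rw [← mem_pow_idealOfVars_succ_iff, Fin.sum_univ_one]
    suffices hsm : s ∈ idealOfVars (Fin n) ℝ ^ (m + 1) by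
      simpa using Ideal.add_mem _ hqs hsm
    refine mem_pow_idealOfVars_of_isLittleO fun v => ?_
    obtain ⟨K, hK⟩ := exists_root_near_line hp hj v
    obtain ⟨w, hw⟩ := hK.choice
    have hlo := isLittleO_along (K := K)
      (hFr.add (isLittleO_eval_of_mem_pow_idealOfVars hqs)) (hw.mono fun τ h => h.2.1)
    refine hlo.neg_left.congr' ?_ EventuallyEq.rfl
    filter_upwards [hw] with τ ⟨h0, _, hwv⟩
    have hsw : eval (w τ) s = eval (τ • v) s := by
      refine eval₂Hom_congr' rfl (fun i hi _ => ?_) rfl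
      exact hwv i (by simpa using mem_supported.1 hs hi)
    rw [hF _ h0, ← hsw]
    simp only [map_sub, map_mul, h0]
    ring
end

section
/- Fix m, k ≥ 1 and let (a₁,b₁), …, (a_k,b_k) ∈ ℝ² ∖ {(0,0)} be pairwise non-proportional, i.e., a_i·b_j ≠ a_j·b_i for all 1 ≤ i < j ≤ k. Then ⟨∏_{i=1}^{k}(a_i x + b_i y)⟩_m = I^m({(x,y) ∈ ℝ² : ∏_{i=1}^{k}(a_i x + b_i y) = 0}); that is, the truncated ideal generated by the product of the k linear forms equals I^m of the union of the corresponding k distinct lines through the origin. -/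
open MvPolynomial Filter Asymptotics Topology

theorem contDiff_eval_mvPolynomial {n : ℕ} {r : WithTop ℕ∞} (p : MvPolynomial (Fin n) ℝ) :
    ContDiff ℝ r (fun v : Fin n → ℝ => eval v p) := by
  simp only [eval_eq']
  fun_prop

theorem eval_isLittleO_of_coeff_eq_zero {n m : ℕ} {p : MvPolynomial (Fin n) ℝ}
    (hp : ∀ d : Fin n →₀ ℕ, (d.sum fun _ e => e) ≤ m → coeff d p = 0) :
    (fun v => eval v p) =o[𝓝 (0 : Fin n → ℝ)] (fun v => ‖v‖ ^ m) := by
  simp only [eval_eq']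
  refine IsLittleO.fun_sum fun d hd => ?_
  have hlt : m < d.sum fun _ e => e := by
    by_contra h
    exact (mem_support_iff.mp hd) (hp d (not_lt.mp h))
  refine IsLittleO.const_mul_left ?_ _
  have hO : (fun v : Fin n → ℝ => ∏ i, v i ^ d i) =O[𝓝 0]
      (fun v => ‖v‖ ^ (d.sum fun _ e => e)) := by
    refine IsBigO.of_bound 1 (Eventually.of_forall fun v => ?_)
    rw [one_mul, norm_pow, norm_norm, norm_prod,
      Finsupp.sum_fintype _ _ (fun _ => rfl), ← Finset.prod_pow_eq_pow_sum]
    refine Finset.prod_le_prod (fun _ _ => norm_nonneg _) fun i _ => ?_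
    rw [norm_pow]
    gcongr
    exact norm_le_pi_norm v i
  exact hO.trans_isLittleO (isLittleO_norm_pow_norm_pow hlt)

theorem Polynomial.eq_zero_of_isLittleO_pow {m : ℕ} {P : Polynomial ℝ} (hdeg : P.natDegree ≤ m)
    (hP : (fun t => P.eval t) =o[𝓝 (0 : ℝ)] (fun t => t ^ m)) : P = 0 := by
  by_contra h0
  obtain ⟨Q, hQ, hndvd⟩ := Polynomial.exists_eq_pow_rootMultiplicity_mul_and_not_dvd P h0 0
  set r := P.rootMultiplicity 0
  have hr : r ≤ m := by
    refine le_trans ?_ hdeg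
    rw [show r = P.roots.count 0 from (Polynomial.count_roots P).symm]
    exact (Multiset.count_le_card 0 _).trans P.card_roots'
  rw [Polynomial.dvd_iff_isRoot, Polynomial.IsRoot.def] at hndvd
  refine hndvd ?_
  have hpow : (fun t : ℝ => t ^ m) =O[𝓝 0] (fun t => t ^ r) := by
    rcases hr.eq_or_lt with h | h
    · rw [h]
    · exact (isLittleO_pow_pow h).isBigO
  have hlim : Tendsto (fun t => Q.eval t) (𝓝[≠] (0 : ℝ)) (𝓝 0) := by
    rw [← isLittleO_one_iff ℝ]
    have hPr : (fun t => P.eval t) =o[𝓝[≠] (0 : ℝ)] (fun t => t ^ r) :=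
      (hP.mono nhdsWithin_le_nhds).trans_isBigO
        (hpow.mono nhdsWithin_le_nhds)
    have hdiv := hPr.mul_isBigO (isBigO_refl (fun t : ℝ => (t ^ r)⁻¹) (𝓝[≠] 0))
    refine hdiv.congr' ?_ ?_ <;>
      filter_upwards [self_mem_nhdsWithin] with t ht <;>
      have ht' : t ≠ 0 := ht
    · rw [hQ]
      simp only [map_zero, sub_zero, Polynomial.eval_mul, Polynomial.eval_pow, Polynomial.eval_X]
      field_simp
    · field_simp
  exact tendsto_nhds_unique (Q.continuous.continuousAt.tendsto.mono_left nhdsWithin_le_nhds) hlim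

/-- Restriction of a polynomial to the line `a x + b y = 0`, parametrised by `t ↦ (b t, -a t)`. -/
noncomputable def restrictToLine (a b : ℝ) : MvPolynomial (Fin 2) ℝ →ₐ[ℝ] Polynomial ℝ :=
  aeval ![Polynomial.C b * Polynomial.X, Polynomial.C (-a) * Polynomial.X]

theorem eval_restrictToLine (a b t : ℝ) (p : MvPolynomial (Fin 2) ℝ) :
    (restrictToLine a b p).eval t = eval (t • ![b, -a]) p := by
  induction p using MvPolynomial.induction_on with
  | C c => simp [restrictToLine]
  | add p q hp hq => simp [hp, hq]
  | mul_X p i hp =>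
    rw [map_mul, Polynomial.eval_mul, hp]
    fin_cases i <;> simp [restrictToLine, mul_comm t]

theorem natDegree_restrictToLine_le (a b : ℝ) (p : MvPolynomial (Fin 2) ℝ) :
    (restrictToLine a b p).natDegree ≤ p.totalDegree := by
  have h := aeval_natDegree_le p le_rfl
    ![Polynomial.C b * Polynomial.X, Polynomial.C (-a) * Polynomial.X] (n := 1) (by
      intro i
      fin_cases i <;> exact (Polynomial.natDegree_C_mul_le _ _).trans Polynomial.natDegree_X_le)
  simpa [restrictToLine] using h

theorem restrictToLine_linearForm (a b c d : ℝ) :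
    restrictToLine a b (C c * X 0 + C d * X 1) =
      Polynomial.C (c * b - d * a) * Polynomial.X := by
  simp only [restrictToLine, map_add, map_mul, aeval_X, algHom_C, Polynomial.algebraMap_eq,
    Matrix.cons_val_zero, Matrix.cons_val_one, Polynomial.C_sub, Polynomial.C_neg]
  ring

theorem linearForm_dvd_of_restrictToLine_eq_zero {a b : ℝ} (hab : (a, b) ≠ (0, 0))
    {p : MvPolynomial (Fin 2) ℝ} (hp : restrictToLine a b p = 0) :
    (C a * X 0 + C b * X 1 : MvPolynomial (Fin 2) ℝ) ∣ p := by
  have hN : a ^ 2 + b ^ 2 ≠ 0 := by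
    intro h
    apply hab
    rw [Prod.mk.injEq]
    constructor <;> nlinarith [sq_nonneg a, sq_nonneg b]
  set N := a ^ 2 + b ^ 2 with hNdef
  have hCN : (C (N⁻¹) * (C a ^ 2 + C b ^ 2) : MvPolynomial (Fin 2) ℝ) = 1 := by
    rw [← C_pow, ← C_pow, ← C_add, ← C_mul, ← hNdef, inv_mul_cancel₀ hN, C_1]
  let L : MvPolynomial (Fin 2) ℝ := C (N⁻¹) * (C b * X 0 - C a * X 1)
  have key : ∀ q : MvPolynomial (Fin 2) ℝ,
      (C a * X 0 + C b * X 1 : MvPolynomial (Fin 2) ℝ) ∣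
        q - Polynomial.aeval L (restrictToLine a b q) := by
    intro q
    induction q using MvPolynomial.induction_on with
    | C c => simp [restrictToLine, MvPolynomial.algebraMap_eq]
    | add q r hq hr =>
      rw [map_add, map_add, add_sub_add_comm]
      exact dvd_add hq hr
    | mul_X q i hq =>
      have hX : (C a * X 0 + C b * X 1 : MvPolynomial (Fin 2) ℝ) ∣
          X i - Polynomial.aeval L (restrictToLine a b (X i)) := by
        fin_cases i
        · refine ⟨C (N⁻¹) * C a, ?_⟩
          simp [restrictToLine, MvPolynomial.algebraMap_eq, L]
          linear_combination (-X 0) * hCN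
        · refine ⟨C (N⁻¹) * C b, ?_⟩
          simp [restrictToLine, MvPolynomial.algebraMap_eq, L]
          linear_combination (-X 1) * hCN
      rw [map_mul, map_mul]
      exact dvd_mul_sub_mul hq hX
  simpa [hp] using key p

theorem prod_linearForm_dvd {ι : Type*} {a b : ι → ℝ} (s : Finset ι)
    (hne : ∀ i, (a i, b i) ≠ (0, 0)) (hprop : ∀ i j, i ≠ j → a i * b j ≠ a j * b i)
    {p : MvPolynomial (Fin 2) ℝ} (hp : ∀ i ∈ s, restrictToLine (a i) (b i) p = 0) :
    ∏ i ∈ s, (C (a i) * X 0 + C (b i) * X 1 : MvPolynomial (Fin 2) ℝ) ∣ p := by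
  classical
  induction s using Finset.induction_on with
  | empty => simp
  | insert i s his ih =>
    obtain ⟨q, rfl⟩ := ih fun j hj => hp j (Finset.mem_insert_of_mem hj)
    have h := hp i (Finset.mem_insert_self i s)
    rw [map_mul, map_prod, mul_eq_zero] at h
    rw [Finset.prod_insert his, mul_comm]
    refine mul_dvd_mul_left _ (linearForm_dvd_of_restrictToLine_eq_zero (hne i) ?_)
    refine h.resolve_left (Finset.prod_ne_zero_iff.mpr fun j hj => ?_)
    rw [restrictToLine_linearForm]
    refine mul_ne_zero (Polynomial.C_ne_zero.mpr (sub_ne_zero.mpr ?_)) Polynomial.X_ne_zero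
    rw [mul_comm (b j)]
    exact hprop j i fun hji => his (hji ▸ hj)

/-- For `k` pairwise non-proportional nonzero linear forms `aᵢx + bᵢy`, the truncated ideal
generated by their product equals `I^m` of the union of the `k` corresponding lines. -/
theorem stmt4 (m k : ℕ) (hm : 1 ≤ m) (hk : 1 ≤ k) (a b : Fin k → ℝ)
    (hne : ∀ i, (a i, b i) ≠ (0, 0))
    (hprop : ∀ i j : Fin k, i < j → a i * b j ≠ a j * b i) :
    truncIdeal 2 m
        (fun _ : Fin 1 => ∏ i, (C (a i) * X 0 + C (b i) * X 1 : MvPolynomial (Fin 2) ℝ)) =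
      Im 2 m {v : Fin 2 → ℝ | ∏ i, (a i * v 0 + b i * v 1) = 0} := by
  ext p
  constructor
  · rintro ⟨hdeg, q, hq⟩
    refine ⟨hdeg, fun v => eval v (q 0 * ∏ i, (C (a i) * X 0 + C (b i) * X 1)),
      contDiff_eval_mvPolynomial _, fun v hv => ?_, ?_⟩
    · have hv' : ∏ i, (a i * v 0 + b i * v 1) = 0 := hv
      simp [hv']
    · refine (eval_isLittleO_of_coeff_eq_zero hq).neg_left.congr_left fun v => ?_
      simp
  · rintro ⟨hdeg, F, -, hF, hlo⟩
    refine ⟨hdeg, ?_⟩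
    have hprop' : ∀ i j, i ≠ j → a i * b j ≠ a j * b i := fun i j hij =>
      hij.lt_or_gt.elim (hprop i j) fun h => (hprop j i h).symm
    obtain ⟨q, hq⟩ := prod_linearForm_dvd Finset.univ hne hprop' (p := p) fun i _ => by
      refine Polynomial.eq_zero_of_isLittleO_pow
        ((natDegree_restrictToLine_le _ _ _).trans hdeg) ?_
      have htend : Tendsto (fun t : ℝ => t • ![b i, -a i]) (𝓝 0) (𝓝 0) := by
        have hc : Continuous (fun t : ℝ => t • ![b i, -a i]) := by fun_prop
        simpa using hc.tendsto 0
      have hline := (hlo.comp_tendsto htend).neg_left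
      have hbig : ((fun v : Fin 2 → ℝ => ‖v‖ ^ m) ∘ fun t : ℝ => t • ![b i, -a i]) =O[𝓝 0]
          (fun t : ℝ => t ^ m) := by
        refine IsBigO.of_bound (‖![b i, -a i]‖ ^ m) (Eventually.of_forall fun t => ?_)
        rw [Function.comp_apply, norm_smul, norm_pow, norm_mul, norm_norm, norm_norm, norm_pow,
          mul_pow, mul_comm]
      refine (hline.trans_isBigO hbig).congr_left fun t => ?_
      have hzero : F (t • ![b i, -a i]) = 0 := hF _ <|
        Finset.prod_eq_zero (Finset.mem_univ i) (by simp; ring)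
      rw [eval_restrictToLine]
      rw [Function.comp_apply, hzero, zero_sub, neg_neg]
    refine ⟨fun _ => q, fun d _ => ?_⟩
    simp [hq, mul_comm]
end

section
/- Fix m ≥ 2 and let E = {(x,y) ∈ ℝ² : x² = y^{2m−1} and x ≥ 0}. Then I^m(E) = ⟨x², xy⟩_m. -/
open MvPolynomial Filter Asymptotics Topology

/-- A real polynomial that is `o(t ^ N)` at `0⁺` has no monomial of degree at most `N`. -/
theorem Polynomial.coeff_eq_zero_of_isLittleO {P : Polynomial ℝ} {N : ℕ}
    (h : (fun t : ℝ => P.eval t) =o[𝓝[>] 0] fun t => t ^ N) {k : ℕ} (hk : k ≤ N) :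
    P.coeff k = 0 := by
  by_cases hP : P = 0
  · simp [hP]
  obtain ⟨Q, hQ, hndvd⟩ := Polynomial.exists_eq_pow_rootMultiplicity_mul_and_not_dvd P hP 0
  set n := P.rootMultiplicity 0
  rw [Polynomial.C_0, sub_zero] at hQ hndvd
  have hn : N < n := by
    by_contra! hn
    apply hndvd
    have hO : (fun t : ℝ => t ^ N) =O[𝓝[>] 0] fun t => t ^ n := by
      refine Asymptotics.IsBigO.of_bound 1 ?_
      filter_upwards [Ioo_mem_nhdsGT one_pos] with t ht
      rw [one_mul, norm_pow, norm_pow, Real.norm_of_nonneg ht.1.le]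
      exact pow_le_pow_of_le_one ht.1.le ht.2.le hn
    have h1 := h.trans_isBigO hO
    have h2 : Tendsto (fun t : ℝ => Q.eval t) (𝓝[>] 0) (𝓝 0) := by
      refine h1.tendsto_div_nhds_zero.congr' ?_
      filter_upwards [self_mem_nhdsWithin] with t ht
      have ht : t ≠ 0 := ne_of_gt ht
      rw [hQ]
      simp [ht]
    have h3 : Tendsto (fun t : ℝ => Q.eval t) (𝓝[>] 0) (𝓝 (Q.eval 0)) :=
      Q.continuous.continuousAt.tendsto.mono_left nhdsWithin_le_nhds
    rw [Polynomial.X_dvd_iff, Polynomial.coeff_zero_eq_eval_zero]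
    exact tendsto_nhds_unique h3 h2
  rw [hQ, Polynomial.coeff_X_pow_mul', if_neg (by omega)]

/-- A polynomial all of whose monomials have degree greater than `m` is `o(‖v‖ ^ m)` at `0`. -/
theorem MvPolynomial.isLittleO_eval_of_coeff_eq_zero {n m : ℕ} {r : MvPolynomial (Fin n) ℝ}
    (hr : ∀ d : Fin n →₀ ℕ, (d.sum fun _ e => e) ≤ m → coeff d r = 0) :
    (fun v => eval v r) =o[𝓝 (0 : Fin n → ℝ)] fun v => ‖v‖ ^ m := by
  simp only [eval_eq]
  refine Asymptotics.IsLittleO.fun_sum fun d hd => ?_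
  refine Asymptotics.IsLittleO.const_mul_left ?_ _
  have hdeg : m < ∑ i, d i := by
    by_contra! h
    exact mem_support_iff.1 hd (hr d (by rwa [Finsupp.sum_fintype _ _ fun _ => rfl]))
  have hO : (fun v : Fin n → ℝ => ∏ i ∈ d.support, v i ^ d i) =O[𝓝 0]
      fun v => ‖v‖ ^ ∑ i, d i := by
    refine Asymptotics.IsBigO.of_norm_le fun v => ?_
    rw [Finset.prod_subset (Finset.subset_univ _) (by simp +contextual), norm_prod,
      ← Finset.prod_pow_eq_pow_sum]
    refine Finset.prod_le_prod (fun _ _ => norm_nonneg _) fun i _ => ?_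
    rw [norm_pow]
    gcongr
    exact norm_le_pi_norm v i
  refine hO.trans_isLittleO ?_
  exact (Asymptotics.isLittleO_pow_pow hdeg).comp_tendsto tendsto_norm_zero

/-- The coefficients of the univariate polynomial `p(t ^ a, t ^ b)`. -/
theorem MvPolynomial.coeff_aeval_X_pow (p : MvPolynomial (Fin 2) ℝ) (a b k : ℕ) :
    (aeval ![(Polynomial.X : Polynomial ℝ) ^ a, Polynomial.X ^ b] p).coeff k =
      ∑ d ∈ p.support, if k = a * d 0 + b * d 1 then coeff d p else 0 := by
  simp only [aeval_def, eval₂_eq', Fin.prod_univ_two, Polynomial.finsetSum_coeff,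
    Polynomial.algebraMap_eq, Polynomial.coeff_C_mul, Matrix.cons_val_zero, Matrix.cons_val_one,
    ← pow_mul, ← pow_add, Polynomial.coeff_X_pow, mul_ite, mul_one, mul_zero]

/-- If `p(t ^ a, t ^ b)` has no term of degree `a * e 0 + b * e 1`, and `e` is the only exponent
contributing to that term, then `p` has no monomial with exponent `e`. -/
theorem MvPolynomial.coeff_eq_zero_of_coeff_aeval_X_pow {p : MvPolynomial (Fin 2) ℝ} {a b : ℕ}
    {e : Fin 2 →₀ ℕ}
    (h : (aeval ![(Polynomial.X : Polynomial ℝ) ^ a, Polynomial.X ^ b] p).coeff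
      (a * e 0 + b * e 1) = 0)
    (huniq : ∀ d : Fin 2 →₀ ℕ, a * e 0 + b * e 1 = a * d 0 + b * d 1 → d = e) :
    coeff e p = 0 := by
  rw [coeff_aeval_X_pow, Finset.sum_eq_single e] at h
  · simpa using h
  · exact fun d _ hd => if_neg fun h' => hd (huniq d h')
  · exact fun he => by simpa using he

/-- A polynomial without monomials `1`, `x`, `y ^ b` lies in the ideal `⟨x², xy⟩`. -/
theorem MvPolynomial.exists_eq_mul_sq_add_mul {p : MvPolynomial (Fin 2) ℝ}
    (hp : ∀ d ∈ p.support, d 0 ≠ 0 ∧ 2 ≤ d 0 + d 1) :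
    ∃ q r : MvPolynomial (Fin 2) ℝ, q * X 0 ^ 2 + r * (X 0 * X 1) = p := by
  rw [← Ideal.mem_span_pair, p.as_sum]
  refine Ideal.sum_mem _ fun d hd => ?_
  obtain ⟨h0, h1⟩ := hp d hd
  rw [monomial_eq, Finsupp.prod_fintype _ _ fun _ => pow_zero _, Fin.prod_univ_two]
  refine Ideal.mul_mem_left _ _ ?_
  by_cases h2 : 2 ≤ d 0
  · exact Ideal.mul_mem_right _ _ (Ideal.mem_of_dvd _ (pow_dvd_pow _ h2)
      (Ideal.subset_span (by simp)))
  · exact Ideal.mem_of_dvd _ (mul_dvd_mul (dvd_pow_self _ h0) (dvd_pow_self _ (by omega)))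
      (Ideal.subset_span (by simp))

/-- A function on the plane bounded by `|y| ^ s` with `s > m` is `o(‖v‖ ^ m)` at `0`. -/
theorem isLittleO_norm_pow_of_abs_le_rpow {m : ℕ} {s : ℝ} (hs : m < s)
    {f : (Fin 2 → ℝ) → ℝ} (hf : ∀ v, |f v| ≤ |v 1| ^ s) :
    f =o[𝓝 0] fun v => ‖v‖ ^ m := by
  have h1 : f =O[𝓝 0] fun v => ‖v‖ ^ m * ‖v‖ ^ (s - m) := by
    refine Asymptotics.IsBigO.of_norm_le fun v => (hf v).trans ?_
    have hs0 : 0 < s := (Nat.cast_nonneg m).trans_lt hs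
    calc |v 1| ^ s ≤ ‖v‖ ^ s := Real.rpow_le_rpow (abs_nonneg _) (norm_le_pi_norm v 1) hs0.le
      _ = ‖v‖ ^ m * ‖v‖ ^ (s - m) := by
        rw [← Real.rpow_natCast, ← Real.rpow_add_of_nonneg (norm_nonneg v) (by positivity)
          (by linarith)]
        congr 1
        ring
  refine h1.trans_isLittleO ?_
  have h2 : Tendsto (fun v : Fin 2 → ℝ => ‖v‖ ^ (s - m)) (𝓝 0) (𝓝 0) := by
    have hc : Continuous fun v : Fin 2 → ℝ => ‖v‖ ^ (s - m) :=
      continuous_norm.rpow_const fun _ => Or.inr (by linarith)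
    have := hc.tendsto 0
    rwa [norm_zero, Real.zero_rpow (by linarith)] at this
  simpa using (Asymptotics.isBigO_refl (fun v : Fin 2 → ℝ => ‖v‖ ^ m) (𝓝 0)).mul_isLittleO
    ((Asymptotics.isLittleO_one_iff ℝ).2 h2)

/-- For `m ≥ 2` and `E = {x² = y^(2m-1), x ≥ 0}`, one has `I^m(E) = ⟨x², xy⟩_m`. -/
theorem stmt5 (m : ℕ) (hm : 2 ≤ m) :
    Im 2 m {v : Fin 2 → ℝ | v 0 ^ 2 = v 1 ^ (2 * m - 1) ∧ 0 ≤ v 0} =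
      truncIdeal 2 m ![(X 0 ^ 2 : MvPolynomial (Fin 2) ℝ), X 0 * X 1] := by
  ext p
  constructor
  · rintro ⟨hdeg, F, -, hFE, hFo⟩
    refine ⟨hdeg, ?_⟩
    have htend : Tendsto (fun t : ℝ => (![t ^ (2 * m - 1), t ^ 2] : Fin 2 → ℝ))
        (𝓝[>] 0) (𝓝 0) := by
      have hc : Continuous fun t : ℝ => (![t ^ (2 * m - 1), t ^ 2] : Fin 2 → ℝ) := by
        fun_prop
      have h0 : (![(0 : ℝ) ^ (2 * m - 1), 0 ^ 2] : Fin 2 → ℝ) = 0 := by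
        ext i
        fin_cases i
        · simp
          omega
        · simp
      exact h0 ▸ (hc.tendsto 0).mono_left nhdsWithin_le_nhds
    have hsmall : (fun t : ℝ => (aeval ![(Polynomial.X : Polynomial ℝ) ^ (2 * m - 1),
        Polynomial.X ^ 2] p).eval t) =o[𝓝[>] 0] fun t => t ^ (2 * m) := by
      have h1 := (hFo.comp_tendsto htend).neg_left
      have h2 : (fun t : ℝ => ‖(![t ^ (2 * m - 1), t ^ 2] : Fin 2 → ℝ)‖ ^ m) =O[𝓝[>] 0]
          fun t => t ^ (2 * m) := by
        refine Asymptotics.IsBigO.of_bound 1 ?_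
        filter_upwards [Ioo_mem_nhdsGT one_pos] with t ht
        rw [one_mul, norm_pow, norm_norm, norm_pow, pow_mul]
        gcongr
        refine (pi_norm_le_iff_of_nonneg (by positivity)).2 fun i => ?_
        have ht' : ‖t‖ ≤ 1 := by rw [Real.norm_of_nonneg ht.1.le]; exact ht.2.le
        fin_cases i
        · simpa using pow_le_pow_of_le_one (norm_nonneg t) ht' (by omega : 2 ≤ 2 * m - 1)
        · simp
      refine (h1.trans_isBigO h2).congr' ?_ .rfl
      filter_upwards [self_mem_nhdsWithin] with t ht
      have ht : 0 < t := ht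
      have hE := hFE ![t ^ (2 * m - 1), t ^ 2] ⟨by simp [← pow_mul, mul_comm], by
        simpa using pow_nonneg ht.le _⟩
      simp only [Function.comp_apply, hE, zero_sub, neg_neg]
      simp [aeval_def, eval₂_eq', eval_eq', Fin.prod_univ_two, Polynomial.eval_finsetSum]
    have hcoeff (e : Fin 2 →₀ ℕ) (hle : (2 * m - 1) * e 0 + 2 * e 1 ≤ 2 * m)
        (huniq : ∀ d : Fin 2 →₀ ℕ,
          (2 * m - 1) * e 0 + 2 * e 1 = (2 * m - 1) * d 0 + 2 * d 1 → d = e) :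
        coeff e p = 0 :=
      coeff_eq_zero_of_coeff_aeval_X_pow
        (Polynomial.coeff_eq_zero_of_isLittleO hsmall hle) huniq
    have hsupp : ∀ d ∈ p.support, d 0 ≠ 0 ∧ 2 ≤ d 0 + d 1 := by
      intro e he
      by_contra hcon
      have hle : e 0 + e 1 ≤ m := by
        have := (le_totalDegree he).trans hdeg
        rwa [Finsupp.sum_fintype _ _ fun _ => rfl, Fin.sum_univ_two] at this
      have hcases : e 0 = 0 ∨ (e 0 = 1 ∧ e 1 = 0) := by omega
      have key : ∀ x y : ℕ, (2 * m - 1) * e 0 + 2 * e 1 = (2 * m - 1) * x + 2 * y →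
          x = e 0 ∧ y = e 1 := by
        intro x y hxy
        obtain rfl | rfl | hx : x = 0 ∨ x = 1 ∨ 2 ≤ x := by omega
        · rcases hcases with h | ⟨h, h'⟩ <;> simp only [h, mul_zero, mul_one] at hxy <;> omega
        · rcases hcases with h | ⟨h, h'⟩ <;> simp only [h, mul_zero, mul_one] at hxy <;> omega
        · have := Nat.mul_le_mul_left (2 * m - 1) hx
          rcases hcases with h | ⟨h, h'⟩ <;> simp only [h, mul_zero, mul_one] at hxy <;> omega
      refine mem_support_iff.1 he (hcoeff e ?_ fun d hd => ?_)
      · rcases hcases with h | ⟨h, h'⟩ <;> simp only [h, mul_zero, mul_one] <;> omega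
      · ext i
        fin_cases i
        · exact (key _ _ hd).1
        · exact (key _ _ hd).2
    obtain ⟨q, r, hqr⟩ := exists_eq_mul_sq_add_mul hsupp
    exact ⟨![q, r], fun d _ => by simp [Fin.sum_univ_two, hqr]⟩
  · rintro ⟨hdeg, q, hq⟩
    have hpoly (r : MvPolynomial (Fin 2) ℝ) : ContDiff ℝ m fun v : Fin 2 → ℝ => eval v r := by
      simp only [eval_eq']
      fun_prop
    have hrpow : ContDiff ℝ m fun y : ℝ => y ^ (m + 1 / 2 : ℝ) :=
      Real.contDiff_rpow_const_of_le (by norm_num)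
    refine ⟨hdeg, fun v => eval v (q 0) * (v 0 ^ 2 - v 1 ^ (2 * m - 1)) +
      eval v (q 1) * (v 0 * v 1 - v 1 ^ (m + 1 / 2 : ℝ)), ?_, ?_, ?_⟩
    · have h0 := hpoly (q 0)
      have h1 := hpoly (q 1)
      have h2 : ContDiff ℝ m fun v : Fin 2 → ℝ => v 1 ^ (m + 1 / 2 : ℝ) :=
        hrpow.comp (contDiff_apply ℝ ℝ 1)
      fun_prop
    · rintro v ⟨hv, hv0⟩
      have hodd : Odd (2 * m - 1) := ⟨m - 1, by omega⟩
      have hy : 0 ≤ v 1 := by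
        rw [← hodd.pow_nonneg_iff, ← hv]
        positivity
      have hx : v 0 = v 1 ^ (m - 1 / 2 : ℝ) := by
        rw [← Real.sqrt_sq hv0, hv, Real.sqrt_eq_rpow, ← Real.rpow_natCast,
          ← Real.rpow_mul hy, Nat.cast_sub (by omega)]
        push_cast
        congr 1
        ring
      have hm' : (2 : ℝ) ≤ m := by exact_mod_cast hm
      have hxy : v 0 * v 1 = v 1 ^ (m + 1 / 2 : ℝ) := by
        rw [hx]
        nth_rewrite 2 [← Real.rpow_one (v 1)]
        rw [← Real.rpow_add_of_nonneg hy (by linarith) zero_le_one]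
        congr 1
        ring
      simp [hv, hxy]
    · have hr := isLittleO_eval_of_coeff_eq_zero hq
      have hbdd (r : MvPolynomial (Fin 2) ℝ) :
          (fun v : Fin 2 → ℝ => eval v r) =O[𝓝 0] fun _ => (1 : ℝ) :=
        (hpoly r).continuous.continuousAt.isBigO_one ℝ
      have h1 : (fun v : Fin 2 → ℝ => v 1 ^ (2 * m - 1)) =o[𝓝 0] fun v => ‖v‖ ^ m := by
        refine isLittleO_norm_pow_of_abs_le_rpow (s := (2 * m - 1 : ℕ)) ?_ fun v => ?_
        · exact_mod_cast (by omega : m < 2 * m - 1)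
        · rw [Real.rpow_natCast, abs_pow]
      have h2 : (fun v : Fin 2 → ℝ => v 1 ^ (m + 1 / 2 : ℝ)) =o[𝓝 0] fun v => ‖v‖ ^ m :=
        isLittleO_norm_pow_of_abs_le_rpow (s := m + 1 / 2) (by norm_num)
          fun v => Real.abs_rpow_le_abs_rpow _ _
      have h3 := ((hbdd (q 0)).mul_isLittleO h1).add ((hbdd (q 1)).mul_isLittleO h2)
      simp only [one_mul] at h3
      refine (hr.neg_left.sub h3).congr_left fun v => ?_
      simp [Fin.sum_univ_two]
      ring
end

section
/- Fix m ≥ 2 and let E = {(x,y) ∈ ℝ² : x·(x² − y^{2m−1}) = 0 and x ≥ 0}. Then I^m(E) = ⟨x²⟩_m. -/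
open MvPolynomial Filter Asymptotics Topology

/-- Weights on the nodes `1, …, m + 1` which extract the linear coefficient of a polynomial of
degree at most `m`. -/
lemma exists_linear_coeff_weights (m : ℕ) : ∃ c : Fin (m + 1) → ℝ, ∀ k : Fin (m + 1),
    ∑ j : Fin (m + 1), c j * ((j : ℝ) + 1) ^ (k : ℕ) = if (k : ℕ) = 1 then 1 else 0 := by
  have hinj : Function.Injective (fun j : Fin (m + 1) => (j : ℝ) + 1) := by
    intro a b hab
    simpa [Fin.ext_iff] using hab
  have hunit : IsUnit (Matrix.vandermonde fun j : Fin (m + 1) => (j : ℝ) + 1).transpose := by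
    rw [Matrix.isUnit_iff_isUnit_det, Matrix.det_transpose, isUnit_iff_ne_zero]
    exact Matrix.det_vandermonde_ne_zero_iff.2 hinj
  obtain ⟨c, hc⟩ := Matrix.mulVec_surjective_iff_isUnit.2 hunit
    (fun k : Fin (m + 1) => if (k : ℕ) = 1 then 1 else 0)
  refine ⟨c, fun k => ?_⟩
  rw [← congrFun hc k]
  simp [Matrix.mulVec, dotProduct, Matrix.vandermonde_apply, mul_comm]

/-- Taylor's formula whose last term is the full `m`-th order term. -/
lemma taylor_lagrange_sub (m : ℕ) (hm : m ≠ 0) {φ : ℝ → ℝ} (hφ : ContDiff ℝ m φ) {x : ℝ}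
    (hx : 0 < x) : ∃ ξ ∈ Set.Ioo 0 x,
      φ x - ∑ k : Fin (m + 1), iteratedDeriv k φ 0 * x ^ (k : ℕ) / (k : ℕ).factorial =
        (iteratedDeriv m φ ξ - iteratedDeriv m φ 0) * x ^ m / m.factorial := by
  obtain ⟨n, rfl⟩ := Nat.exists_eq_succ_of_ne_zero hm
  obtain ⟨ξ, hξ, h⟩ := taylor_mean_remainder_lagrange_iteratedDeriv (n := n) hx.ne
    (f := φ) (by exact_mod_cast hφ.contDiffOn)
  rw [Set.uIoo_of_le hx.le] at hξ
  refine ⟨ξ, hξ, ?_⟩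
  rw [taylor_within_apply, sub_zero, Set.uIcc_of_le hx.le] at h
  have hsum : ∑ k ∈ Finset.range (n + 1),
      (((k.factorial : ℝ))⁻¹ * x ^ k) • iteratedDerivWithin k φ (Set.Icc 0 x) 0 =
      ∑ k : Fin (n + 1), iteratedDeriv k φ 0 * x ^ (k : ℕ) / (k : ℕ).factorial := by
    rw [Finset.sum_range]
    refine Finset.sum_congr rfl fun k _ => ?_
    rw [iteratedDerivWithin_eq_iteratedDeriv (uniqueDiffOn_Icc hx)
      ((hφ.of_le (by exact_mod_cast k.2.le)).contDiffAt) ⟨le_rfl, hx.le⟩, smul_eq_mul]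
    ring
  rw [hsum] at h
  rw [Nat.succ_eq_add_one, Fin.sum_univ_castSucc]
  simp only [Fin.val_castSucc, Fin.val_last]
  linear_combination h

/-- A `C^m` function on a segment which is small, and whose `m`-th derivative oscillates little,
has small derivative at the end point. -/
lemma exists_abs_deriv_mul_le (m : ℕ) (hm : m ≠ 0) : ∃ C : ℝ, 0 < C ∧
    ∀ (φ : ℝ → ℝ) (s A B : ℝ), ContDiff ℝ m φ → 0 < s →
      (∀ t ∈ Set.Icc 0 ((m + 1) * s), |φ t| ≤ A) →
      (∀ t ∈ Set.Icc 0 ((m + 1) * s), |iteratedDeriv m φ t - iteratedDeriv m φ 0| ≤ B) →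
      |deriv φ 0| * s ≤ C * (A + B * s ^ m) := by
  obtain ⟨c, hc⟩ := exists_linear_coeff_weights m
  refine ⟨∑ j, |c j| * ((m : ℝ) + 1) ^ m + 1, by positivity, fun φ s A B hφ hs hA hB => ?_⟩
  have hnode : ∀ j : Fin (m + 1), 0 < ((j : ℝ) + 1) * s ∧ ((j : ℝ) + 1) * s ≤ (m + 1) * s := by
    intro j
    refine ⟨by positivity, ?_⟩
    have : (j : ℝ) ≤ m := by exact_mod_cast Nat.lt_succ_iff.1 j.2
    gcongr
  have hA0 : 0 ≤ A := (abs_nonneg _).trans (hA 0 ⟨le_rfl, by positivity⟩)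
  have hB0 : 0 ≤ B := (abs_nonneg _).trans (hB 0 ⟨le_rfl, by positivity⟩)
  choose ξ hξ hT using fun j => taylor_lagrange_sub m hm hφ (hnode j).1
  have hsum : deriv φ 0 * s = ∑ j, c j * ∑ k : Fin (m + 1),
      iteratedDeriv k φ 0 * (((j : ℝ) + 1) * s) ^ (k : ℕ) / (k : ℕ).factorial := by
    have hswap : ∀ k : Fin (m + 1), ∑ j : Fin (m + 1), c j *
        (iteratedDeriv k φ 0 * (((j : ℝ) + 1) * s) ^ (k : ℕ) / (k : ℕ).factorial) =
        if k = ⟨1, by omega⟩ then deriv φ 0 * s else 0 := by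
      intro k
      have : ∑ j : Fin (m + 1), c j *
          (iteratedDeriv k φ 0 * (((j : ℝ) + 1) * s) ^ (k : ℕ) / (k : ℕ).factorial) =
          (iteratedDeriv k φ 0 * s ^ (k : ℕ) / (k : ℕ).factorial) *
            ∑ j : Fin (m + 1), c j * ((j : ℝ) + 1) ^ (k : ℕ) := by
        rw [Finset.mul_sum]
        refine Finset.sum_congr rfl fun j _ => ?_
        rw [mul_pow]
        ring
      rw [this, hc k]
      by_cases hk : (k : ℕ) = 1
      · simp [hk, Fin.ext_iff]
      · simp [hk, Fin.ext_iff]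
    simp_rw [Finset.mul_sum]
    rw [Finset.sum_comm]
    simp_rw [hswap]
    simp
  have hterm : ∀ j : Fin (m + 1), |∑ k : Fin (m + 1),
      iteratedDeriv k φ 0 * (((j : ℝ) + 1) * s) ^ (k : ℕ) / (k : ℕ).factorial| ≤
        ((m : ℝ) + 1) ^ m * (A + B * s ^ m) := by
    intro j
    have hj := hnode j
    have h1 := hA _ ⟨hj.1.le, hj.2⟩
    have h2 := hB (ξ j) ⟨(hξ j).1.le, (hξ j).2.le.trans hj.2⟩
    have h3 : |(iteratedDeriv m φ (ξ j) - iteratedDeriv m φ 0) * (((j : ℝ) + 1) * s) ^ m /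
        m.factorial| ≤ B * ((m + 1) * s) ^ m := by
      rw [abs_div, abs_mul, abs_of_nonneg (pow_nonneg hj.1.le m), Nat.abs_cast]
      refine (div_le_self (by positivity) (by exact_mod_cast m.factorial_pos)).trans ?_
      gcongr
      exact Nat.lt_succ_iff.1 j.2
    rw [← hT j] at h3
    have h4 : (1 : ℝ) ≤ ((m : ℝ) + 1) ^ m := one_le_pow₀ (by simp)
    rw [mul_pow] at h3
    have h5 := abs_sub_abs_le_abs_sub (∑ k : Fin (m + 1),
      iteratedDeriv k φ 0 * (((j : ℝ) + 1) * s) ^ (k : ℕ) / (k : ℕ).factorial)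
      (φ (((j : ℝ) + 1) * s))
    rw [abs_sub_comm] at h5
    nlinarith [mul_nonneg hA0 (sub_nonneg.2 h4)]
  have hAB : 0 ≤ A + B * s ^ m := by positivity
  calc |deriv φ 0| * s = |deriv φ 0 * s| := by rw [abs_mul, abs_of_pos hs]
    _ ≤ ∑ j, |c j| * (((m : ℝ) + 1) ^ m * (A + B * s ^ m)) := by
      rw [hsum]
      refine (Finset.abs_sum_le_sum_abs _ _).trans (Finset.sum_le_sum fun j _ => ?_)
      rw [abs_mul]
      exact mul_le_mul_of_nonneg_left (hterm j) (abs_nonneg _)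
    _ = (∑ j, |c j| * ((m : ℝ) + 1) ^ m) * (A + B * s ^ m) := by
      rw [Finset.sum_mul]
      simp_rw [mul_assoc]
    _ ≤ _ := by gcongr; simp

lemma exists_norm_le_of_homogeneous {E W : Type} [NormedAddCommGroup E] [NormedSpace ℝ E]
    [FiniteDimensional ℝ E] [NormedAddCommGroup W] [NormedSpace ℝ W] {k : ℕ} {G : E → W}
    (hG : ∀ v ≠ 0, ContinuousAt G v) (h0 : G 0 = 0)
    (hh : ∀ t : ℝ, 0 < t → ∀ v, G (t • v) = (t ^ k * √t) • G v) :
    ∃ C, ∀ v, ‖G v‖ ≤ C * (‖v‖ ^ k * √‖v‖) := by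
  have : ProperSpace E := FiniteDimensional.proper ℝ E
  obtain ⟨C, hC⟩ := (isCompact_sphere (0 : E) 1).exists_bound_of_continuousOn (f := G)
    fun v hv => (hG v (ne_zero_of_mem_unit_sphere ⟨v, hv⟩)).continuousWithinAt
  refine ⟨C, fun v => ?_⟩
  rcases eq_or_ne v 0 with rfl | hv
  · simp [h0]
  · have hn : 0 < ‖v‖ := norm_pos_iff.2 hv
    have h1 := hh ‖v‖ hn (‖v‖⁻¹ • v)
    rw [smul_inv_smul₀ hn.ne'] at h1
    rw [h1, norm_smul, Real.norm_of_nonneg (by positivity), mul_comm]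
    gcongr
    exact hC _ (by simp [norm_smul, hn.ne'])

lemma isLittleO_of_homogeneous {E W : Type} [NormedAddCommGroup E] [NormedSpace ℝ E]
    [FiniteDimensional ℝ E] [NormedAddCommGroup W] [NormedSpace ℝ W] {k : ℕ} {G : E → W}
    (hG : ∀ v ≠ 0, ContinuousAt G v) (h0 : G 0 = 0)
    (hh : ∀ t : ℝ, 0 < t → ∀ v, G (t • v) = (t ^ k * √t) • G v) :
    G =o[𝓝 0] fun v => ‖v‖ ^ k := by
  obtain ⟨C, hC⟩ := exists_norm_le_of_homogeneous hG h0 hh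
  have hO : G =O[𝓝 0] fun v => ‖v‖ ^ k * √‖v‖ := by
    refine IsBigO.of_bound C (Eventually.of_forall fun v => ?_)
    rw [Real.norm_of_nonneg (by positivity)]
    exact hC v
  refine hO.trans_isLittleO ?_
  have hs : (fun v : E => √‖v‖) =o[𝓝 0] fun _ => (1 : ℝ) := by
    rw [isLittleO_one_iff]
    have : Continuous fun v : E => √‖v‖ := by fun_prop
    simpa using this.tendsto 0
  simpa using (isBigO_refl (fun v : E => ‖v‖ ^ k) (𝓝 0)).mul_isLittleO hs

/-- A function which is smooth away from the origin and positively homogeneous of degree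
`k + 1/2` is of class `C^k`. -/
lemma contDiff_of_homogeneous {E : Type} [NormedAddCommGroup E] [NormedSpace ℝ E]
    [FiniteDimensional ℝ E] (k : ℕ) : ∀ {W : Type} [NormedAddCommGroup W] [NormedSpace ℝ W]
    {G : E → W}, (∀ v ≠ 0, ContDiffAt ℝ (⊤ : ℕ∞) G v) → G 0 = 0 →
    (∀ t : ℝ, 0 < t → ∀ v, G (t • v) = (t ^ k * √t) • G v) → ContDiff ℝ k G := by
  induction k with
  | zero =>
    intro W _ _ G hG h0 hh
    rw [Nat.cast_zero, contDiff_zero, continuous_iff_continuousAt]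
    intro v
    rcases eq_or_ne v 0 with rfl | hv
    · have := isLittleO_of_homogeneous (fun v hv => (hG v hv).continuousAt) h0 hh
      simp only [pow_zero, isLittleO_one_iff] at this
      rwa [ContinuousAt, h0]
    · exact (hG v hv).continuousAt
  | succ k ih =>
    intro W _ _ G hG h0 hh
    have hd0 : HasFDerivAt G (0 : E →L[ℝ] W) 0 := by
      have := isLittleO_of_homogeneous (fun v hv => (hG v hv).continuousAt) h0 hh
      rw [hasFDerivAt_iff_isLittleO_nhds_zero]
      simp only [zero_add, h0, sub_zero, zero_apply]
      refine this.trans_isBigO (IsBigO.of_bound 1 ?_)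
      filter_upwards [Metric.closedBall_mem_nhds (0 : E) one_pos] with v hv
      rw [mem_closedBall_zero_iff] at hv
      rw [norm_pow, norm_norm, pow_succ, one_mul]
      exact mul_le_of_le_one_left (norm_nonneg _) (pow_le_one₀ (norm_nonneg _) hv)
    have hd : Differentiable ℝ G := by
      intro v
      rcases eq_or_ne v 0 with rfl | hv
      · exact hd0.differentiableAt
      · exact (hG v hv).differentiableAt (by simp)
    rw [Nat.cast_add, Nat.cast_one, contDiff_succ_iff_fderiv]
    refine ⟨hd, by simp, ih (fun v hv => (hG v hv).fderiv_right (by simp)) hd0.fderiv ?_⟩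
    intro t ht v
    have h1 : fderiv ℝ (fun x => G (t • x)) v = t • fderiv ℝ G (t • v) := fderiv_comp_smul t
    have h2 : (fun x => G (t • x)) = (t ^ (k + 1) * √t) • G := by
      ext x
      exact hh t ht x
    rw [h2, fderiv_const_smul (hd v)] at h1
    rw [← inv_smul_smul₀ ht.ne' (fderiv ℝ G (t • v)), ← h1, smul_smul]
    congr 1
    field_simp
    ring

lemma iteratedDeriv_comp_line {E : Type} [NormedAddCommGroup E] [NormedSpace ℝ E] {m : ℕ}
    {H : E → ℝ} (hH : ContDiff ℝ m H) (v e : E) (t : ℝ) :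
    iteratedDeriv m (fun t : ℝ => H (v + t • e)) t =
      iteratedFDeriv ℝ m H (v + t • e) fun _ => e := by
  have h := ContinuousLinearMap.iteratedFDeriv_comp_right (ContinuousLinearMap.toSpanSingleton ℝ e)
    (f := fun z => H (v + z)) (hH.comp (contDiff_const.add contDiff_id)) t (i := m) le_rfl
  rw [iteratedFDeriv_comp_add_left] at h
  rw [iteratedDeriv_eq_iteratedFDeriv]
  have h' := congrArg (fun L => L fun _ => (1 : ℝ)) h
  simpa [Function.comp_def] using h'

/-- If a `C^m` function is `o(‖v‖^m)` at the origin then its directional derivatives are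
`o(‖v‖^(m-1))`. -/
lemma ContDiff.isLittleO_fderiv_apply {E : Type} [NormedAddCommGroup E] [NormedSpace ℝ E] {m : ℕ}
    (hm : m ≠ 0) {H : E → ℝ} (hH : ContDiff ℝ m H) (ho : H =o[𝓝 0] fun v => ‖v‖ ^ m) {e : E}
    (he : ‖e‖ ≤ 1) : (fun v => fderiv ℝ H v e) =o[𝓝[≠] 0] fun v => ‖v‖ ^ (m - 1) := by
  obtain ⟨C, hC, hbound⟩ := exists_abs_deriv_mul_le m hm
  rw [isLittleO_iff]
  intro ε hε
  set K : ℝ := C * (((m : ℝ) + 2) ^ m + 2) with hK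
  have hKpos : 0 < K := by positivity
  have hδ : 0 < ε / K := by positivity
  have hcont : Continuous fun v => iteratedFDeriv ℝ m H v fun _ => e :=
    (ContinuousMultilinearMap.apply ℝ (fun _ : Fin m => E) ℝ fun _ => e).continuous.comp
      (hH.continuous_iteratedFDeriv le_rfl)
  have hnear := (isLittleO_iff.1 ho hδ).and (Metric.tendsto_nhds.1 (hcont.tendsto 0) _ hδ)
  obtain ⟨r, hr, hball⟩ := Metric.eventually_nhds_iff_ball.1 hnear
  have hr' : 0 < r / (m + 2) := by positivity
  filter_upwards [nhdsWithin_le_nhds (Metric.ball_mem_nhds (0 : E) hr'), self_mem_nhdsWithin]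
    with v hv hv0
  have hs : 0 < ‖v‖ := norm_pos_iff.2 hv0
  rw [mem_ball_zero_iff, lt_div_iff₀ (by positivity)] at hv
  have hmem : ∀ t ∈ Set.Icc 0 ((m + 1) * ‖v‖), ‖v + t • e‖ ≤ (m + 2) * ‖v‖ := by
    intro t ht
    have h1 : ‖t • e‖ ≤ (m + 1) * ‖v‖ := by
      rw [norm_smul, Real.norm_of_nonneg ht.1]
      exact (mul_le_of_le_one_right ht.1 he).trans ht.2
    linarith [norm_add_le v (t • e)]
  have hmem' : ∀ t ∈ Set.Icc 0 ((m + 1) * ‖v‖), v + t • e ∈ Metric.ball (0 : E) r := by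
    intro t ht
    rw [mem_ball_zero_iff]
    linarith [hmem t ht]
  have h0mem : (0 : ℝ) ∈ Set.Icc 0 ((m + 1) * ‖v‖) := ⟨le_rfl, by positivity⟩
  have key := hbound (fun t : ℝ => H (v + t • e)) ‖v‖ (ε / K * ((m + 2) * ‖v‖) ^ m)
    (2 * (ε / K)) (hH.comp (by fun_prop)) hs ?_ ?_
  · have hderiv : deriv (fun t : ℝ => H (v + t • e)) 0 = fderiv ℝ H v e := by
      have h1 : HasDerivAt (fun t : ℝ => v + t • e) e 0 := by
        simpa using ((hasDerivAt_id (0 : ℝ)).smul_const e).const_add v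
      have h2 : HasFDerivAt H (fderiv ℝ H v) (v + (0 : ℝ) • e) := by
        simpa using (hH.differentiable (by exact_mod_cast hm) v).hasFDerivAt
      exact (h2.comp_hasDerivAt 0 h1).deriv
    rw [hderiv, mul_pow] at key
    have hfin : C * (ε / K * (((m : ℝ) + 2) ^ m * ‖v‖ ^ m) + 2 * (ε / K) * ‖v‖ ^ m) =
        ε * ‖v‖ ^ (m - 1) * ‖v‖ := by
      rw [mul_assoc ε, pow_sub_one_mul hm]
      calc _ = ε / K * K * ‖v‖ ^ m := by rw [hK]; ring
        _ = _ := by rw [div_mul_cancel₀ _ hKpos.ne']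
    rw [hfin] at key
    rw [norm_pow, norm_norm, Real.norm_eq_abs]
    exact le_of_mul_le_mul_right key hs
  · intro t ht
    have := (hball _ (hmem' t ht)).1
    rw [norm_pow, norm_norm, Real.norm_eq_abs] at this
    refine this.trans ?_
    gcongr
    exact hmem t ht
  · intro t ht
    have h1 := (hball _ (hmem' t ht)).2
    have h2 := (hball _ (hmem' 0 h0mem)).2
    rw [iteratedDeriv_comp_line hH, iteratedDeriv_comp_line hH, ← Real.dist_eq]
    linarith [dist_triangle_right (iteratedFDeriv ℝ m H (v + t • e) fun _ => e)
      (iteratedFDeriv ℝ m H (v + (0 : ℝ) • e) fun _ => e) (iteratedFDeriv ℝ m H 0 fun _ => e)]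

lemma Polynomial.X_pow_dvd_of_isLittleO (m : ℕ) : ∀ a : Polynomial ℝ,
    (fun y => a.eval y) =o[𝓝[>] 0] (fun y : ℝ => y ^ m) → Polynomial.X ^ (m + 1) ∣ a := by
  induction m with
  | zero =>
    intro a ha
    simp only [pow_zero, isLittleO_one_iff] at ha
    rw [zero_add, pow_one, Polynomial.X_dvd_iff, Polynomial.coeff_zero_eq_eval_zero]
    exact tendsto_nhds_unique ((a.continuous.tendsto 0).mono_left nhdsWithin_le_nhds) ha
  | succ m ih =>
    intro a ha
    have h0 : (fun y => a.eval y) =o[𝓝[>] 0] (fun y : ℝ => y ^ m) := by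
      refine ha.trans_isBigO ?_
      have : (fun y : ℝ => y) =O[𝓝[>] 0] fun _ => (1 : ℝ) :=
        ((continuous_id.tendsto (0 : ℝ)).mono_left nhdsWithin_le_nhds).isBigO_one ℝ
      simpa [pow_succ] using (isBigO_refl (fun y : ℝ => y ^ m) _).mul this
    obtain ⟨b, rfl⟩ := (dvd_pow_self Polynomial.X m.succ_ne_zero).trans (ih a h0)
    rw [pow_succ']
    refine mul_dvd_mul_left _ (ih b ?_)
    rw [isLittleO_iff] at ha ⊢
    intro c hc
    filter_upwards [ha hc, self_mem_nhdsWithin] with y hy hy0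
    have hy0' : 0 < ‖y‖ := norm_pos_iff.2 (ne_of_gt hy0)
    rw [Polynomial.eval_mul, Polynomial.eval_X, norm_mul, pow_succ', norm_mul] at hy
    exact le_of_mul_le_mul_left (hy.trans_eq (by ring)) hy0'

/-- A bivariate polynomial is the sum of its parts of degree `0` and `1` in the first variable and
a multiple of the square of the first variable. -/
lemma MvPolynomial.exists_eq_add_X_mul_add_X_sq_mul (p : MvPolynomial (Fin 2) ℝ) :
    ∃ (a b : Polynomial ℝ) (q : MvPolynomial (Fin 2) ℝ),
      p = Polynomial.aeval (X 1) a + X 0 * Polynomial.aeval (X 1) b + X 0 ^ 2 * q := by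
  induction p using MvPolynomial.induction_on with
  | C r => exact ⟨Polynomial.C r, 0, 0, by simp [MvPolynomial.algebraMap_eq]⟩
  | add p p' hp hp' =>
    obtain ⟨a, b, q, rfl⟩ := hp
    obtain ⟨a', b', q', rfl⟩ := hp'
    exact ⟨a + a', b + b', q + q', by simp only [map_add]; ring⟩
  | mul_X p i hp =>
    obtain ⟨a, b, q, rfl⟩ := hp
    fin_cases i
    · exact ⟨0, a, Polynomial.aeval (X 1) b + X 0 * q, by simp only [map_zero, Fin.zero_eta]; ring⟩
    · exact ⟨a * Polynomial.X, b * Polynomial.X, q * X 1, by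
        simp only [map_mul, Polynomial.aeval_X, Fin.mk_one]; ring⟩

lemma MvPolynomial.coeff_mul_monomial_eq_zero {σ : Type} {d s : σ →₀ ℕ}
    (h : (d.sum fun _ e => e) < s.sum fun _ e => e) (r : MvPolynomial σ ℝ) :
    coeff d (r * monomial s 1) = 0 := by
  rw [coeff_mul_monomial', if_neg]
  intro hle
  exact absurd (Finsupp.degree_mono hle) (not_le.2 h)

/-- A polynomial without monomials of degree at most `m` is `o(‖v‖^m)` at the origin. -/
lemma MvPolynomial.isLittleO_eval {n m : ℕ} (r : MvPolynomial (Fin n) ℝ)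
    (hr : ∀ d : Fin n →₀ ℕ, (d.sum fun _ e => e) ≤ m → coeff d r = 0) :
    (fun v => eval v r) =o[𝓝 (0 : Fin n → ℝ)] fun v => ‖v‖ ^ m := by
  simp_rw [eval_eq']
  refine IsLittleO.fun_sum fun d hd => IsLittleO.const_mul_left ?_ _
  have hdeg : m < ∑ i, d i := by
    rw [mem_support_iff] at hd
    by_contra hle
    refine hd (hr d ?_)
    rw [Finsupp.sum_fintype _ _ fun _ => rfl]
    exact not_lt.1 hle
  have hO : (fun v : Fin n → ℝ => ∏ i, v i ^ d i) =O[𝓝 0] fun v => ‖v‖ ^ (∑ i, d i) := by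
    refine IsBigO.of_bound 1 (Eventually.of_forall fun v => ?_)
    rw [norm_prod, one_mul, norm_pow, norm_norm, ← Finset.prod_pow_eq_pow_sum]
    refine Finset.prod_le_prod (fun _ _ => norm_nonneg _) fun i _ => ?_
    rw [norm_pow]
    gcongr
    exact norm_le_pi_norm v i
  exact hO.trans_isLittleO (isLittleO_norm_pow_norm_pow hdeg)

/-- A function of class `C^m`, homogeneous of degree `m + 1/2`, which vanishes for `x = 0` and
agrees with `x * y ^ (m - 1/2)` for `|x| ≤ y`. -/
noncomputable def coneCutoff (m : ℕ) (v : Fin 2 → ℝ) : ℝ :=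
  if 0 < v 1 then v 0 * (v 1 ^ (m - 1) * √(v 1)) * Real.smoothTransition (2 - (v 0 / v 1) ^ 2)
  else 0

lemma coneCutoff_of_nonpos {m : ℕ} {v : Fin 2 → ℝ} (h : v 1 ≤ 0) : coneCutoff m v = 0 :=
  if_neg h.not_gt

lemma coneCutoff_of_fst_eq_zero {m : ℕ} {v : Fin 2 → ℝ} (h : v 0 = 0) : coneCutoff m v = 0 := by
  simp [coneCutoff, h]

lemma coneCutoff_of_abs_le {m : ℕ} {v : Fin 2 → ℝ} (h1 : 0 < v 1) (h : |v 0| ≤ v 1) :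
    coneCutoff m v = v 0 * (v 1 ^ (m - 1) * √(v 1)) := by
  have : (v 0 / v 1) ^ 2 ≤ 1 := by
    rw [sq_le_one_iff_abs_le_one, abs_div, abs_of_pos h1]
    exact div_le_one_of_le₀ h h1.le
  rw [coneCutoff, if_pos h1, Real.smoothTransition.one_of_one_le (by linarith), mul_one]

lemma coneCutoff_of_le_abs {m : ℕ} {v : Fin 2 → ℝ} (h : 2 * v 1 ≤ |v 0|) :
    coneCutoff m v = 0 := by
  by_cases h1 : 0 < v 1
  · have : 2 ≤ |v 0 / v 1| := by
      rwa [abs_div, abs_of_pos h1, le_div_iff₀ h1]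
    have : 2 ^ 2 ≤ (v 0 / v 1) ^ 2 := by
      rw [← sq_abs (v 0 / v 1)]
      gcongr
    rw [coneCutoff, if_pos h1, Real.smoothTransition.zero_of_nonpos (by linarith), mul_zero]
  · exact if_neg h1

lemma coneCutoff_smul {m : ℕ} (hm : m ≠ 0) {t : ℝ} (ht : 0 < t) (v : Fin 2 → ℝ) :
    coneCutoff m (t • v) = (t ^ m * √t) • coneCutoff m v := by
  simp only [coneCutoff, Pi.smul_apply, smul_eq_mul, mul_pos_iff_of_pos_left ht]
  split_ifs
  · rw [mul_div_mul_left _ _ ht.ne', Real.sqrt_mul ht.le, mul_pow, ← mul_pow_sub_one hm t]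
    ring
  · simp

lemma contDiffAt_coneCutoff (m : ℕ) {v : Fin 2 → ℝ} (hv : v ≠ 0) :
    ContDiffAt ℝ (⊤ : ℕ∞) (coneCutoff m) v := by
  have c0 : Continuous fun w : Fin 2 → ℝ => w 0 := continuous_apply 0
  have c1 : Continuous fun w : Fin 2 → ℝ => w 1 := continuous_apply 1
  by_cases h1 : 0 < v 1
  · have heq : coneCutoff m =ᶠ[𝓝 v] fun w => w 0 * (w 1 ^ (m - 1) * √(w 1)) *
        Real.smoothTransition (2 - (w 0 / w 1) ^ 2) := by
      filter_upwards [(isOpen_lt continuous_const c1).mem_nhds h1] with w hw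
      exact if_pos hw
    refine ContDiffAt.congr_of_eventuallyEq ?_ heq
    have d0 : ContDiffAt ℝ (⊤ : ℕ∞) (fun w : Fin 2 → ℝ => w 0) v :=
      (contDiff_apply ℝ ℝ 0).contDiffAt
    have d1 : ContDiffAt ℝ (⊤ : ℕ∞) (fun w : Fin 2 → ℝ => w 1) v :=
      (contDiff_apply ℝ ℝ 1).contDiffAt
    exact (d0.mul ((d1.pow _).mul (d1.sqrt h1.ne'))).mul
      (Real.smoothTransition.contDiff.contDiffAt.comp v
        (contDiffAt_const.sub ((d0.div d1 h1.ne').pow 2)))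
  · have h : 2 * v 1 < |v 0| := by
      rcases (not_lt.1 h1).lt_or_eq with h | h
      · linarith [abs_nonneg (v 0)]
      · have : v 0 ≠ 0 := fun h0 => hv (by ext i; fin_cases i <;> assumption)
        rw [h, mul_zero]
        exact abs_pos.2 this
    have heq : coneCutoff m =ᶠ[𝓝 v] fun _ => 0 := by
      filter_upwards [(isOpen_lt (continuous_const.mul c1) c0.abs).mem_nhds h] with w hw
      exact coneCutoff_of_le_abs hw.le
    exact contDiffAt_const.congr_of_eventuallyEq heq

lemma contDiff_coneCutoff {m : ℕ} (hm : m ≠ 0) : ContDiff ℝ m (coneCutoff m) :=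
  contDiff_of_homogeneous m (fun _ => contDiffAt_coneCutoff m)
    (coneCutoff_of_fst_eq_zero rfl) fun _ ht v => coneCutoff_smul hm ht v

lemma isLittleO_coneCutoff {m : ℕ} (hm : m ≠ 0) :
    coneCutoff m =o[𝓝 0] fun v => ‖v‖ ^ m :=
  isLittleO_of_homogeneous (fun _ hv => (contDiffAt_coneCutoff m hv).continuousAt)
    (coneCutoff_of_fst_eq_zero rfl) fun _ ht v => coneCutoff_smul hm ht v

lemma sq_pow_mul_sqrt {m : ℕ} (hm : m ≠ 0) {y : ℝ} (hy : 0 ≤ y) :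
    (y ^ (m - 1) * √y) ^ 2 = y ^ (2 * m - 1) := by
  rw [mul_pow, Real.sq_sqrt hy, ← pow_mul, ← pow_succ]
  congr 1
  omega

lemma pow_mul_sqrt_le {m : ℕ} (hm : 2 ≤ m) {y : ℝ} (hy : 0 ≤ y) (hy1 : y ≤ 1) :
    y ^ (m - 1) * √y ≤ y :=
  calc y ^ (m - 1) * √y ≤ y ^ 1 * 1 := by
        gcongr ?_ * ?_
        · exact pow_le_pow_of_le_one hy hy1 (by omega)
        · exact Real.sqrt_le_one.2 hy1
    _ = y := by simp

lemma fst_sq_eq_coneCutoff {m : ℕ} (hm : 2 ≤ m) {v : Fin 2 → ℝ}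
    (hv : v 0 * (v 0 ^ 2 - v 1 ^ (2 * m - 1)) = 0) (hv0 : 0 ≤ v 0) (hv1 : v 1 ≤ 1) :
    v 0 ^ 2 = coneCutoff m v := by
  rcases mul_eq_zero.1 hv with h | h
  · rw [coneCutoff_of_fst_eq_zero h, h, zero_pow two_ne_zero]
  rcases le_or_gt (v 1) 0 with h1 | h1
  · have : v 1 ^ (2 * m - 1) ≤ 0 := Odd.pow_nonpos ⟨m - 1, by omega⟩ h1
    rw [coneCutoff_of_nonpos h1]
    nlinarith [sq_nonneg (v 0)]
  · have hcurve : v 0 = v 1 ^ (m - 1) * √(v 1) := by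
      refine (pow_left_inj₀ hv0 (by positivity) two_ne_zero).1 ?_
      rw [sq_pow_mul_sqrt (by omega) h1.le]
      linarith
    have hle : |v 0| ≤ v 1 := by
      rw [abs_of_nonneg hv0, hcurve]
      exact pow_mul_sqrt_le hm h1.le hv1
    rw [coneCutoff_of_abs_le h1 hle, ← hcurve, sq]

lemma MvPolynomial.contDiff_eval_s6 {n : ℕ} (p : MvPolynomial (Fin n) ℝ) {k : WithTop ℕ∞} :
    ContDiff ℝ k fun v => eval v p := by
  simp_rw [eval_eq']
  fun_prop

lemma truncIdeal_subset_Im_s6 (m : ℕ) (hm : 2 ≤ m) :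
    truncIdeal 2 m (fun _ : Fin 1 => (X 0 ^ 2 : MvPolynomial (Fin 2) ℝ)) ⊆
      Im 2 m {v : Fin 2 → ℝ | v 0 * (v 0 ^ 2 - v 1 ^ (2 * m - 1)) = 0 ∧ 0 ≤ v 0} := by
  rintro p ⟨hp, q, hq⟩
  have hm0 : m ≠ 0 := by omega
  let ψ : ContDiffBump (0 : Fin 2 → ℝ) := ⟨1 / 2, 1, by norm_num, by norm_num⟩
  refine ⟨hp, fun v => ψ v * (eval v (q 0) * (v 0 ^ 2 - coneCutoff m v)), ?_, ?_, ?_⟩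
  · exact ψ.contDiff.mul ((MvPolynomial.contDiff_eval_s6 _).mul
      (((contDiff_apply ℝ ℝ 0).pow 2).sub (contDiff_coneCutoff hm0)))
  · rintro v ⟨hv, hv0⟩
    beta_reduce
    rcases le_or_gt 1 ‖v‖ with h | h
    · rw [ψ.zero_of_le_dist (by simpa using h), zero_mul]
    · have h1 : v 1 ≤ 1 := (le_abs_self _).trans ((norm_le_pi_norm v 1).trans h.le)
      rw [fst_sq_eq_coneCutoff hm hv hv0 h1, sub_self, mul_zero, mul_zero]
  · have h1 := MvPolynomial.isLittleO_eval _ hq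
    have h2 : (fun v => eval v (q 0) * coneCutoff m v) =o[𝓝 0] fun v : Fin 2 → ℝ => ‖v‖ ^ m := by
      have hO : (fun v => eval v (q 0)) =O[𝓝 0] fun _ : Fin 2 → ℝ => (1 : ℝ) :=
        ((MvPolynomial.contDiff_eval_s6 (k := 0) (q 0)).continuous.tendsto 0).isBigO_one ℝ
      simpa using hO.mul_isLittleO (isLittleO_coneCutoff hm0)
    refine (h1.neg_left.sub h2).congr' ?_ EventuallyEq.rfl
    filter_upwards [Metric.closedBall_mem_nhds (0 : Fin 2 → ℝ) (ψ.rIn_pos)] with v hv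
    rw [ψ.one_of_mem_closedBall hv]
    simp
    ring

lemma MvPolynomial.eval_aeval_X {n : ℕ} (v : Fin n → ℝ) (i : Fin n) (a : Polynomial ℝ) :
    eval v (Polynomial.aeval (X i) a) = a.eval (v i) := by
  induction a using Polynomial.induction_on' with
  | add a b ha hb => simp [ha, hb]
  | monomial n r => simp [Polynomial.aeval_monomial, MvPolynomial.algebraMap_eq]

/-- Along the curve `x = y ^ (m - 1/2)` the mean value theorem controls the part of `p` which is
linear in `x`. -/
lemma isLittleO_linear_part {m : ℕ} (hm : 2 ≤ m) {F : (Fin 2 → ℝ) → ℝ} (hF : ContDiff ℝ m F)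
    (hE : ∀ v : Fin 2 → ℝ, v 0 * (v 0 ^ 2 - v 1 ^ (2 * m - 1)) = 0 → 0 ≤ v 0 → F v = 0)
    {a b : Polynomial ℝ} {q : MvPolynomial (Fin 2) ℝ}
    (ho : (fun v => F v - eval v (Polynomial.aeval (X 1) a + X 0 * Polynomial.aeval (X 1) b +
      X 0 ^ 2 * q)) =o[𝓝 (0 : Fin 2 → ℝ)] fun v => ‖v‖ ^ m) :
    (fun y => b.eval y) =o[𝓝[>] 0] fun y : ℝ => y ^ (m - 1) := by
  set p := Polynomial.aeval (X 1) a + X 0 * Polynomial.aeval (X 1) b + X 0 ^ 2 * q with hp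
  set H : (Fin 2 → ℝ) → ℝ := fun v => F v - eval v p with hHdef
  have hH : ContDiff ℝ m H := hF.sub (MvPolynomial.contDiff_eval_s6 p)
  have hm0 : m ≠ 0 := by omega
  have he : ‖(Pi.single 0 1 : Fin 2 → ℝ)‖ ≤ 1 := by simp [Pi.norm_single]
  have hder := hH.isLittleO_fderiv_apply hm0 ho he
  have hq : (fun y : ℝ => eval ![y ^ (m - 1) * √y, y] q) =O[𝓝[>] 0] fun _ => (1 : ℝ) := by
    have hc : Continuous fun y : ℝ => eval ![y ^ (m - 1) * √y, y] q := by
      refine (MvPolynomial.contDiff_eval_s6 (k := 0) q).continuous.comp ?_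
      refine continuous_pi fun i => ?_
      fin_cases i
      · exact (continuous_pow _).mul Real.continuous_sqrt
      · exact continuous_id
    exact ((hc.tendsto 0).mono_left nhdsWithin_le_nhds).isBigO_one ℝ
  have hsqrt : (fun y : ℝ => √y) =o[𝓝[>] 0] fun _ => (1 : ℝ) := by
    rw [isLittleO_one_iff]
    have h := Real.continuous_sqrt.tendsto 0
    rw [Real.sqrt_zero] at h
    exact h.mono_left nhdsWithin_le_nhds
  have hcq : (fun y : ℝ => y ^ (m - 1) * √y * eval ![y ^ (m - 1) * √y, y] q) =o[𝓝[>] 0]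
      fun y : ℝ => y ^ (m - 1) := by
    simpa using ((isBigO_refl (fun y : ℝ => y ^ (m - 1)) _).mul_isLittleO hsqrt).mul_isBigO hq
  have hsum : (fun y : ℝ => b.eval y + y ^ (m - 1) * √y * eval ![y ^ (m - 1) * √y, y] q)
      =o[𝓝[>] 0] fun y : ℝ => y ^ (m - 1) := by
    rw [isLittleO_iff] at hder ⊢
    intro ε hε
    obtain ⟨r, hr, hball⟩ := Metric.mem_nhdsWithin_iff.1 (hder hε)
    filter_upwards [Ioo_mem_nhdsGT (lt_min hr one_pos)] with y hy
    have hy0 : 0 < y := hy.1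
    have hy1 : y ≤ 1 := (hy.2.trans_le (min_le_right _ _)).le
    set c := y ^ (m - 1) * √y with hc
    have hc0 : 0 < c := by positivity
    have hline : ∀ t, HasDerivAt (fun t : ℝ => ![t, y]) (Pi.single 0 1) t := by
      intro t
      rw [hasDerivAt_pi]
      intro i
      fin_cases i
      · simpa using hasDerivAt_id' t
      · simpa using hasDerivAt_const t y
    have hφ : ∀ t, HasDerivAt (fun t : ℝ => H ![t, y]) (fderiv ℝ H ![t, y] (Pi.single 0 1)) t :=
      fun t => (hH.differentiable (by exact_mod_cast hm0) _).hasFDerivAt.comp_hasDerivAt t (hline t)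
    obtain ⟨ξ, hξ, hslope⟩ := exists_hasDerivAt_eq_slope _ _ hc0
      (fun t _ => (hφ t).continuousAt.continuousWithinAt) fun t _ => hφ t
    have hHc : H ![c, y] = -(a.eval y + c * b.eval y + c ^ 2 * eval ![c, y] q) := by
      have : F ![c, y] = 0 := hE _ (by simp [hc, sq_pow_mul_sqrt hm0 hy0.le]) hc0.le
      simp [hHdef, this, hp, MvPolynomial.eval_aeval_X]
    have hH0 : H ![0, y] = -a.eval y := by
      have : F ![0, y] = 0 := hE _ (by simp) (by simp)
      simp [hHdef, this, hp, MvPolynomial.eval_aeval_X]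
    have hval : fderiv ℝ H ![ξ, y] (Pi.single 0 1) = -(b.eval y + c * eval ![c, y] q) := by
      rw [hslope, hHc, hH0, div_eq_iff (by simpa using hc0.ne')]
      ring
    have hnorm : ‖![ξ, y]‖ = y := by
      have hξy : ξ ≤ y := hξ.2.le.trans (pow_mul_sqrt_le hm hy0.le hy1)
      refine le_antisymm ((pi_norm_le_iff_of_nonneg hy0.le).2 fun i => ?_) ?_
      · fin_cases i
        · simpa [abs_of_pos hξ.1] using hξy
        · simp [abs_of_pos hy0]
      · simpa [abs_of_pos hy0] using norm_le_pi_norm ![ξ, y] 1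
    have := hball (a := ![ξ, y]) ⟨by
      rw [mem_ball_zero_iff, hnorm]; exact hy.2.trans_le (min_le_left _ _), by
      intro h
      exact hy0.ne' (by simpa using congrFun h 1)⟩
    simp only [Set.mem_ofPred_eq, hval, hnorm, norm_neg] at this
    exact this
  simpa using hsum.sub hcq

lemma isLittleO_constant_part {m : ℕ} {F : (Fin 2 → ℝ) → ℝ}
    (hE : ∀ v : Fin 2 → ℝ, v 0 = 0 → F v = 0)
    {a b : Polynomial ℝ} {q : MvPolynomial (Fin 2) ℝ}
    (ho : (fun v => F v - eval v (Polynomial.aeval (X 1) a + X 0 * Polynomial.aeval (X 1) b +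
      X 0 ^ 2 * q)) =o[𝓝 (0 : Fin 2 → ℝ)] fun v => ‖v‖ ^ m) :
    (fun y => a.eval y) =o[𝓝[>] 0] fun y : ℝ => y ^ m := by
  have hline : Tendsto (fun y : ℝ => ![0, y]) (𝓝[>] 0) (𝓝 (0 : Fin 2 → ℝ)) := by
    have hc : Continuous fun y : ℝ => ![0, y] := by fun_prop
    refine Tendsto.mono_left ?_ nhdsWithin_le_nhds
    have h0 : (![0, 0] : Fin 2 → ℝ) = 0 := by ext i; fin_cases i <;> rfl
    simpa only [h0] using hc.tendsto 0
  have h := (ho.comp_tendsto hline).neg_left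
  refine h.congr' (Eventually.of_forall fun y => ?_) ?_
  · simp [hE ![0, y] rfl, MvPolynomial.eval_aeval_X]
  · filter_upwards [self_mem_nhdsWithin] with y hy
    have hy0 : (0 : ℝ) < y := hy
    have hnorm : ‖![0, y]‖ = y := by
      refine le_antisymm ((pi_norm_le_iff_of_nonneg hy0.le).2 fun i => ?_) ?_
      · fin_cases i
        · simpa using hy0.le
        · simp [abs_of_pos hy0]
      · simpa [abs_of_pos hy0] using norm_le_pi_norm ![0, y] 1
    simp [Function.comp_apply, hnorm]

lemma Im_subset_truncIdeal (m : ℕ) (hm : 2 ≤ m) :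
    Im 2 m {v : Fin 2 → ℝ | v 0 * (v 0 ^ 2 - v 1 ^ (2 * m - 1)) = 0 ∧ 0 ≤ v 0} ⊆
      truncIdeal 2 m (fun _ : Fin 1 => (X 0 ^ 2 : MvPolynomial (Fin 2) ℝ)) := by
  rintro p ⟨hp, F, hF, hE, ho⟩
  obtain ⟨a, b, q, rfl⟩ := p.exists_eq_add_X_mul_add_X_sq_mul
  obtain ⟨a', rfl⟩ := Polynomial.X_pow_dvd_of_isLittleO m a
    (isLittleO_constant_part (fun v hv => hE v ⟨by simp [hv], hv.ge⟩) ho)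
  obtain ⟨b', rfl⟩ := Polynomial.X_pow_dvd_of_isLittleO (m - 1) b
    (isLittleO_linear_part hm hF (fun v h h0 => hE v ⟨h, h0⟩) ho)
  refine ⟨hp, fun _ => q, fun d hd => ?_⟩
  have h1 : (X 1 ^ (m + 1) : MvPolynomial (Fin 2) ℝ) = monomial (Finsupp.single 1 (m + 1)) 1 :=
    X_pow_eq_monomial
  have h2 : (X 0 * X 1 ^ m : MvPolynomial (Fin 2) ℝ) =
      monomial (Finsupp.single 0 1 + Finsupp.single 1 m) 1 := by
    rw [X_pow_eq_monomial, X, monomial_mul, one_mul]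
  have hdecomp : Polynomial.aeval (X 1) (Polynomial.X ^ (m + 1) * a') +
      X 0 * Polynomial.aeval (X 1) (Polynomial.X ^ (m - 1 + 1) * b') + X 0 ^ 2 * q -
        ∑ _i : Fin 1, q * X 0 ^ 2 =
      Polynomial.aeval (X 1) a' * monomial (Finsupp.single (1 : Fin 2) (m + 1)) (1 : ℝ) +
      Polynomial.aeval (X 1) b' *
        monomial (Finsupp.single (0 : Fin 2) 1 + Finsupp.single 1 m) (1 : ℝ) := by
    rw [← h1, ← h2, Nat.sub_add_cancel (by omega)]
    simp only [map_mul, map_pow, Polynomial.aeval_X, Finset.univ_unique, Finset.sum_const,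
      Finset.card_singleton, one_smul]
    ring
  rw [hdecomp, coeff_add, MvPolynomial.coeff_mul_monomial_eq_zero _,
    MvPolynomial.coeff_mul_monomial_eq_zero _, add_zero]
  · refine hd.trans_lt ?_
    rw [Finsupp.sum_fintype _ _ fun _ => rfl]
    simp [Fin.sum_univ_two]
  · refine hd.trans_lt ?_
    rw [Finsupp.sum_fintype _ _ fun _ => rfl]
    simp [Fin.sum_univ_two]

/-- For `m ≥ 2` and `E = {x·(x² - y^(2m-1)) = 0, x ≥ 0}`, one has `I^m(E) = ⟨x²⟩_m`. -/
theorem stmt6 (m : ℕ) (hm : 2 ≤ m) :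
    Im 2 m {v : Fin 2 → ℝ | v 0 * (v 0 ^ 2 - v 1 ^ (2 * m - 1)) = 0 ∧ 0 ≤ v 0} =
      truncIdeal 2 m (fun _ : Fin 1 => (X 0 ^ 2 : MvPolynomial (Fin 2) ℝ)) :=
  (Im_subset_truncIdeal m hm).antisymm (truncIdeal_subset_Im_s6 m hm)
end

section
/- Fix m ≥ 1 and n ≥ 2. Let E' ⊆ ℝ^{n−1} be a closed set containing the origin, and suppose I^m(E') = ⟨p₁, …, p_l⟩_m for some polynomials p₁, …, p_l in the variables x₁, …, x_{n−1} vanishing at 0. Let E = {(x₁,…,x_n) ∈ ℝⁿ : (x₁,…,x_{n−1}) ∈ E' and x_n = 0}. Then I^m(E) = ⟨p₁, …, p_l, x_n⟩_m, where the p_i are regarded as polynomials in n variables. -/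
open MvPolynomial Filter Asymptotics Topology

/-- Restriction of a polynomial to the hyperplane where the last variable vanishes. -/
noncomputable def restrictLast (n : ℕ) :
    MvPolynomial (Fin (n + 1)) ℝ →ₐ[ℝ] MvPolynomial (Fin n) ℝ :=
  aeval (Fin.snoc (α := fun _ => MvPolynomial (Fin n) ℝ) X 0)

@[simp]
lemma restrictLast_X_last (n : ℕ) : restrictLast n (X (Fin.last n)) = 0 := by
  simp [restrictLast]

@[simp]
lemma restrictLast_X_castSucc (n : ℕ) (i : Fin n) : restrictLast n (X i.castSucc) = X i := by
  simp [restrictLast]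

@[simp]
lemma restrictLast_rename {n : ℕ} (q : MvPolynomial (Fin n) ℝ) :
    restrictLast n (rename Fin.castSucc q) = q := by
  have h : (restrictLast n).comp (rename Fin.castSucc) = AlgHom.id ℝ _ := by
    ext i
    simp
  exact DFunLike.congr_fun h q

lemma exists_eq_rename_restrictLast_add {n : ℕ} (p : MvPolynomial (Fin (n + 1)) ℝ) :
    ∃ r, p = rename Fin.castSucc (restrictLast n p) + r * X (Fin.last n) := by
  induction p using MvPolynomial.induction_on with
  | C a => exact ⟨0, by simp [restrictLast]⟩
  | add p q hp hq =>
    obtain ⟨r, hr⟩ := hp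
    obtain ⟨s, hs⟩ := hq
    refine ⟨r + s, ?_⟩
    rw [map_add, map_add]
    linear_combination hr + hs
  | mul_X p i hp =>
    obtain ⟨r, hr⟩ := hp
    refine Fin.lastCases ⟨p, by simp⟩ (fun i => ⟨r * X i.castSucc, ?_⟩) i
    rw [map_mul, map_mul, restrictLast_X_castSucc, rename_X]
    linear_combination X i.castSucc * hr

lemma eval_restrictLast {n : ℕ} (p : MvPolynomial (Fin (n + 1)) ℝ) (x : Fin n → ℝ) :
    eval x (restrictLast n p) =
      eval (Fin.snoc (α := fun _ => ℝ) x 0 : Fin (n + 1) → ℝ) p := by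
  obtain ⟨r, hr⟩ := exists_eq_rename_restrictLast_add p
  conv_rhs => rw [hr]
  have h : (Fin.snoc (α := fun _ => ℝ) x 0 : Fin (n + 1) → ℝ) ∘ Fin.castSucc = x := by
    ext i
    simp
  simp [eval_rename, h]

lemma coeff_restrictLast {n : ℕ} (p : MvPolynomial (Fin (n + 1)) ℝ) (d : Fin n →₀ ℕ) :
    coeff d (restrictLast n p) = coeff (d.mapDomain Fin.castSucc) p := by
  obtain ⟨r, hr⟩ := exists_eq_rename_restrictLast_add p
  conv_rhs => rw [hr]
  have h : Fin.last n ∉ (d.mapDomain Fin.castSucc).support := by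
    rw [Finsupp.notMem_support_iff]
    refine Finsupp.mapDomain_of_notMem_range _ _ ?_
    rintro ⟨i, hi⟩
    exact (Fin.castSucc_lt_last i).ne hi
  rw [coeff_add, coeff_rename_mapDomain _ (Fin.castSucc_injective n), coeff_mul_X', if_neg h,
    add_zero]

lemma sum_mapDomain_degree {σ τ : Type*} (f : σ → τ) (d : σ →₀ ℕ) :
    ((d.mapDomain f).sum fun _ e => e) = d.sum fun _ e => e :=
  Finsupp.sum_mapDomain_index (fun _ => rfl) (fun _ _ _ => rfl)

lemma totalDegree_restrictLast_le {n : ℕ} (p : MvPolynomial (Fin (n + 1)) ℝ) :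
    (restrictLast n p).totalDegree ≤ p.totalDegree := by
  refine Finset.sup_le fun d hd => ?_
  rw [mem_support_iff, coeff_restrictLast] at hd
  rw [← sum_mapDomain_degree Fin.castSucc]
  exact le_totalDegree (mem_support_iff.2 hd)

lemma mem_truncIdeal_snoc_iff {n m l : ℕ} (ps : Fin l → MvPolynomial (Fin n) ℝ)
    (p : MvPolynomial (Fin (n + 1)) ℝ) (hp : p.totalDegree ≤ m) :
    p ∈ truncIdeal (n + 1) m
        (Fin.snoc (fun i => rename (Fin.castSucc : Fin n → Fin (n + 1)) (ps i))
          (X (Fin.last n))) ↔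
      restrictLast n p ∈ truncIdeal n m ps := by
  constructor
  · rintro ⟨-, q, hq⟩
    refine ⟨(totalDegree_restrictLast_le p).trans hp,
      fun i => restrictLast n (q i.castSucc), fun d hd => ?_⟩
    rw [← hq (d.mapDomain Fin.castSucc) (by rwa [sum_mapDomain_degree]), ← coeff_restrictLast]
    simp [Fin.sum_univ_castSucc]
  · rintro ⟨-, q, hq⟩
    obtain ⟨r, hr⟩ := exists_eq_rename_restrictLast_add p
    refine ⟨hp, Fin.snoc (fun i => rename Fin.castSucc (q i)) r, fun d hd => ?_⟩
    have h : p - ∑ i, (Fin.snoc (fun i => rename Fin.castSucc (q i)) r :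
          Fin (l + 1) → MvPolynomial (Fin (n + 1)) ℝ) i *
        (Fin.snoc (fun i => rename Fin.castSucc (ps i)) (X (Fin.last n)) :
          Fin (l + 1) → MvPolynomial (Fin (n + 1)) ℝ) i =
        rename Fin.castSucc (restrictLast n p - ∑ i, q i * ps i) := by
      simp only [Fin.sum_univ_castSucc, Fin.snoc_castSucc, Fin.snoc_last, map_sub, map_sum,
        map_mul]
      linear_combination hr
    rw [h]
    refine coeff_rename_eq_zero _ _ _ fun u hu => hq u ?_
    rwa [← sum_mapDomain_degree Fin.castSucc, hu]

lemma mem_Im_hyperplane_iff {n m : ℕ} (E' : Set (Fin n → ℝ))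
    (p : MvPolynomial (Fin (n + 1)) ℝ) (hp : p.totalDegree ≤ m) :
    p ∈ Im (n + 1) m
        {x : Fin (n + 1) → ℝ | (fun i : Fin n => x i.castSucc) ∈ E' ∧ x (Fin.last n) = 0} ↔
      restrictLast n p ∈ Im n m E' := by
  constructor
  · rintro ⟨-, F, hF, hF0, ho⟩
    let ι : (Fin n → ℝ) → Fin (n + 1) → ℝ := fun x => Fin.snoc (α := fun _ => ℝ) x 0
    have hι : ContDiff ℝ m ι := by
      refine contDiff_pi.2 (Fin.lastCases ?_ fun i => ?_)
      · simpa [ι] using contDiff_const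
      · simpa [ι] using contDiff_apply ℝ ℝ i
    have hι0 : ι 0 = 0 := by
      ext i
      refine Fin.lastCases ?_ (fun i => ?_) i <;> simp [ι]
    have hnorm (x) : ‖ι x‖ ≤ ‖x‖ := by
      refine (pi_norm_le_iff_of_nonneg (norm_nonneg x)).2 (Fin.lastCases ?_ fun i => ?_)
      · simp [ι]
      · simpa [ι] using norm_le_pi_norm x i
    refine ⟨(totalDegree_restrictLast_le p).trans hp, F ∘ ι, hF.comp hι,
      fun x hx => hF0 _ (by simpa [ι] using hx), ?_⟩
    have ht : Tendsto ι (𝓝 0) (𝓝 0) := by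
      simpa only [hι0] using hι.continuous.tendsto 0
    have ho' := ho.comp_tendsto ht
    simp only [eval_restrictLast]
    refine ho'.trans_isBigO (IsBigO.of_bound' (Eventually.of_forall fun x => ?_))
    simpa using pow_le_pow_left₀ (norm_nonneg _) (hnorm x) m
  · rintro ⟨-, F, hF, hF0, ho⟩
    obtain ⟨r, hr⟩ := exists_eq_rename_restrictLast_add p
    let π : (Fin (n + 1) → ℝ) → Fin n → ℝ := fun x i => x i.castSucc
    have hπ : ContDiff ℝ m π := contDiff_pi.2 fun i => contDiff_apply ℝ ℝ i.castSucc
    have hnorm (x) : ‖π x‖ ≤ ‖x‖ :=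
      (pi_norm_le_iff_of_nonneg (norm_nonneg x)).2 fun i => norm_le_pi_norm x i.castSucc
    have hr' : ContDiff ℝ m fun x : Fin (n + 1) → ℝ => eval x r :=
      (AnalyticOnNhd.eval_mvPolynomial r).contDiff
    refine ⟨hp, fun x => F (π x) + eval x r * x (Fin.last n),
      (hF.comp hπ).add (hr'.mul (contDiff_apply ℝ ℝ _)), ?_, ?_⟩
    · rintro x ⟨hx, hx0⟩
      simp [hx0, hF0 (π x) hx]
    have ht : Tendsto π (𝓝 0) (𝓝 0) := hπ.continuous.tendsto 0
    have ho' := ho.comp_tendsto ht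
    have heq (x : Fin (n + 1) → ℝ) : F (π x) + eval x r * x (Fin.last n) - eval x p =
        F (π x) - eval (π x) (restrictLast n p) := by
      have h := congrArg (eval x) hr
      rw [map_add, map_mul, eval_X, eval_rename] at h
      rw [h]
      simp only [π, Function.comp_def]
      ring
    simp only [heq]
    refine ho'.trans_isBigO (IsBigO.of_bound' (Eventually.of_forall fun x => ?_))
    simpa using pow_le_pow_left₀ (norm_nonneg _) (hnorm x) m

/-- If `E' ⊆ ℝⁿ` is closed, contains the origin, and `I^m(E') = ⟨p₁,…,p_l⟩_m`, then for
`E = E' × {0} ⊆ ℝⁿ⁺¹` one has `I^m(E) = ⟨p₁,…,p_l, x_{n+1}⟩_m`. -/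
theorem stmt7 (m n l : ℕ) (hm : 1 ≤ m) (hn : 1 ≤ n)
    (E' : Set (Fin n → ℝ)) (hclosed : IsClosed E') (h0 : (0 : Fin n → ℝ) ∈ E')
    (ps : Fin l → MvPolynomial (Fin n) ℝ)
    (hps0 : ∀ i, eval (0 : Fin n → ℝ) (ps i) = 0)
    (hI : Im n m E' = truncIdeal n m ps) :
    Im (n + 1) m
        {x : Fin (n + 1) → ℝ | (fun i : Fin n => x i.castSucc) ∈ E' ∧ x (Fin.last n) = 0} =
      truncIdeal (n + 1) m
        (Fin.snoc (fun i => rename (Fin.castSucc : Fin n → Fin (n + 1)) (ps i))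
          (X (Fin.last n))) := by
  ext p
  constructor
  · intro h
    rw [mem_truncIdeal_snoc_iff ps p h.1, ← hI]
    exact (mem_Im_hyperplane_iff E' p h.1).1 h
  · intro h
    rw [mem_Im_hyperplane_iff E' p h.1, hI]
    exact (mem_truncIdeal_snoc_iff ps p h.1).1 h
end

section
/- Fix m ≥ 1 and let E ⊆ ℝ be a closed set with 0 ∈ E. If 0 is an isolated point of E, then I^m(E) consists of all polynomials of degree ≤ m vanishing at 0; if 0 is not an isolated point of E, then I^m(E) = {0}. In particular, I^m(E) is always either the zero ideal or all of the degree-≤m polynomials vanishing at 0. -/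
open MvPolynomial Filter Asymptotics Topology

/-- A polynomial of degree at most `m` which is `o(x ^ m)` along a punctured filter at `0`
vanishes. -/
theorem Polynomial.eq_zero_of_isLittleO_pow_s8 {m : ℕ} {q : Polynomial ℝ} (hq : q.natDegree ≤ m)
    {l : Filter ℝ} [l.NeBot] (hl : l ≤ 𝓝[≠] 0)
    (ho : (fun x => q.eval x) =o[l] fun x => x ^ m) : q = 0 := by
  by_contra hne
  obtain ⟨r, hr, hdvd⟩ := Polynomial.exists_eq_pow_rootMultiplicity_mul_and_not_dvd q hne 0
  have hk : q.rootMultiplicity 0 ≤ m := by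
    have := Polynomial.natDegree_le_of_dvd ⟨r, hr⟩ hne
    refine le_trans ?_ hq
    simpa using this
  generalize q.rootMultiplicity 0 = k at hr hk
  have hl0 : l ≤ 𝓝 0 := hl.trans nhdsWithin_le_nhds
  have hpow : (fun x : ℝ => x ^ m) =O[l] fun x => x ^ k := by
    have hO : (fun x : ℝ => x ^ (m - k)) =O[l] fun _ => (1 : ℝ) :=
      (((continuous_pow (m - k)).tendsto (0 : ℝ)).mono_left hl0).isBigO_one ℝ
    have := (isBigO_refl (fun x : ℝ => x ^ k) l).mul hO
    simpa [← pow_add, Nat.add_sub_cancel' hk] using this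
  have hro : (fun x => r.eval x) =o[l] fun _ => (1 : ℝ) := by
    have hinv := (isBigO_refl (fun x : ℝ => (x ^ k)⁻¹) l).mul_isLittleO (ho.trans_isBigO hpow)
    have hx : ∀ᶠ x in l, x ≠ (0 : ℝ) := hl self_mem_nhdsWithin
    refine hinv.congr' ?_ ?_
    · filter_upwards [hx] with x hx
      rw [hr]
      simp [hx]
    · filter_upwards [hx] with x hx
      simp [hx]
  have hr0 : r.eval 0 = 0 :=
    tendsto_nhds_unique ((r.continuous.tendsto 0).mono_left hl0)
      ((isLittleO_one_iff ℝ).1 hro)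
  exact hdvd (Polynomial.dvd_iff_isRoot.2 hr0)

theorem MvPolynomial.eval_aeval_X_fin_one (p : MvPolynomial (Fin 1) ℝ) (v : Fin 1 → ℝ) :
    (aeval (fun _ => (Polynomial.X : Polynomial ℝ)) p).eval (v 0) = eval v p := by
  induction p using MvPolynomial.induction_on with
  | C a => simp
  | add p q hp hq => simp [hp, hq]
  | mul_X p i hp => simp [hp, Subsingleton.elim i 0]

/-- If `0` is isolated in `E`, every polynomial vanishing at `0` agrees near `0` with a `C^m`
function vanishing on `E`. -/
theorem MvPolynomial.exists_contDiff_eq_zero_of_isolated {n : ℕ} (m : ℕ)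
    {E : Set (Fin n → ℝ)} {ε : ℝ} (hε : 0 < ε) (hE : ∀ x ∈ E, ‖x‖ < ε → x = 0)
    {p : MvPolynomial (Fin n) ℝ} (hp : eval 0 p = 0) :
    ∃ F : (Fin n → ℝ) → ℝ, ContDiff ℝ m F ∧ (∀ x ∈ E, F x = 0) ∧
      F =ᶠ[𝓝 0] fun v => eval v p := by
  let χ : ContDiffBump (0 : Fin n → ℝ) := ⟨ε / 2, ε, half_pos hε, half_lt_self hε⟩
  have hpc : ContDiff ℝ m fun v : Fin n → ℝ => eval v p := by
    simp only [MvPolynomial.eval_eq]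
    fun_prop
  refine ⟨fun v => χ v * eval v p, χ.contDiff.mul hpc, fun x hx => ?_, ?_⟩
  · by_cases h : ‖x‖ < ε
    · simp only [hE x hx h, hp, mul_zero]
    · simp only [χ.zero_of_le_dist (x := x) (by simpa [χ] using h), zero_mul]
  · filter_upwards [χ.eventuallyEq_one] with v hv
    simp [hv]

/-- For a closed `E ⊆ ℝ` containing `0`: if `0` is isolated in `E` then `I^m(E)` is all
polynomials of degree ≤ m vanishing at `0`; otherwise `I^m(E) = {0}`. -/
theorem stmt8 (m : ℕ) (hm : 1 ≤ m) (E : Set (Fin 1 → ℝ)) (hclosed : IsClosed E)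
    (h0 : (0 : Fin 1 → ℝ) ∈ E) :
    ((∃ ε > (0 : ℝ), ∀ x ∈ E, ‖x‖ < ε → x = 0) →
        Im 1 m E = {p | p.totalDegree ≤ m ∧ eval (0 : Fin 1 → ℝ) p = 0}) ∧
      (¬ (∃ ε > (0 : ℝ), ∀ x ∈ E, ‖x‖ < ε → x = 0) →
        Im 1 m E = {0}) := by
  refine ⟨?_, fun hacc => ?_⟩
  · rintro ⟨ε, hε, hE⟩
    ext p
    constructor
    · rintro ⟨hd, F, -, hF0, ho⟩
      refine ⟨hd, ?_⟩
      have h := (ho.bound one_pos).self_of_nhds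
      simpa [hF0 0 h0, zero_pow (by omega : m ≠ 0)] using h
    · rintro ⟨hd, hp⟩
      obtain ⟨F, hF, hFE, hFp⟩ :=
        MvPolynomial.exists_contDiff_eq_zero_of_isolated m hε hE hp
      refine ⟨hd, F, hF, hFE, (isLittleO_zero _ _).congr' ?_ .rfl⟩
      filter_upwards [hFp] with v hv
      simp [hv]
  · ext p
    constructor
    · rintro ⟨hd, F, -, hF0, ho⟩
      have hne : (𝓝[E \ {0}] (0 : Fin 1 → ℝ)).NeBot := by
        rw [← mem_closure_iff_nhdsWithin_neBot, Metric.mem_closure_iff]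
        intro ε hε
        by_contra hcon
        refine hacc ⟨ε, hε, fun x hx hxε => ?_⟩
        by_contra hx0
        exact hcon ⟨x, ⟨hx, hx0⟩, by simpa using hxε⟩
      have hmap : Tendsto (fun v : Fin 1 → ℝ => v 0) (𝓝[E \ {0}] 0) (𝓝[≠] 0) := by
        refine tendsto_nhdsWithin_iff.2 ⟨?_, ?_⟩
        · exact ((continuous_apply 0).tendsto (0 : Fin 1 → ℝ)).mono_left nhdsWithin_le_nhds
        · filter_upwards [self_mem_nhdsWithin] with v hv h
          exact hv.2 (funext fun i => by rw [Subsingleton.elim i 0]; exact h)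
      have hq : aeval (fun _ => (Polynomial.X : Polynomial ℝ)) p = 0 := by
        refine Polynomial.eq_zero_of_isLittleO_pow_s8 (m := m) ?_ hmap (isLittleO_map.2 ?_)
        · simpa using MvPolynomial.aeval_natDegree_le p hd
            (fun _ => (Polynomial.X : Polynomial ℝ)) (fun _ => Polynomial.natDegree_X_le)
        · refine ((ho.mono nhdsWithin_le_nhds).neg_left.congr' ?_ .rfl).trans_isBigO
            (IsBigO.of_bound 1 (.of_forall fun v => ?_))
          · filter_upwards [self_mem_nhdsWithin] with v hv
            simp [hF0 v hv.1, MvPolynomial.eval_aeval_X_fin_one]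
          · simp [Pi.norm_def]
      refine MvPolynomial.funext fun v => ?_
      rw [← MvPolynomial.eval_aeval_X_fin_one, hq]
      simp
    · rintro rfl
      exact ⟨by simp, 0, contDiff_const, fun _ _ => rfl, by simp⟩
end

section
/- Let E = {(x,y) ∈ ℝ² : x² = y⁴}. Then I²(E) = ⟨x²⟩₂; in particular, the polynomial xy does not belong to I²(E). -/
open MvPolynomial Filter Asymptotics Topology

/-- A `C²` function which is `o(‖v‖²)` at the origin has a derivative which is `o(‖v‖)`. -/
lemma ContDiff.isLittleO_fderiv_of_isLittleO_sq {E : Type*} [NormedAddCommGroup E]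
    [NormedSpace ℝ E] {f : E → ℝ} (hf : ContDiff ℝ 2 f)
    (hfo : f =o[𝓝 0] fun v => ‖v‖ ^ 2) : fderiv ℝ f =o[𝓝 0] fun v => v := by
  have hdiff : Differentiable ℝ f := hf.differentiable (by norm_num)
  have hdiff' : Differentiable ℝ (fderiv ℝ f) :=
    (hf.fderiv_right (m := 1) (by norm_num)).differentiable (by norm_num)
  have hf0 : f 0 = 0 := by
    have := hfo.isBigO.eq_zero_imp.self_of_nhds
    simpa using this
  have hfderiv : fderiv ℝ f 0 = 0 := by
    apply HasFDerivAt.fderiv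
    rw [hasFDerivAt_iff_isLittleO_nhds_zero]
    have h2 : (fun v : E => ‖v‖ ^ 2) =o[𝓝 0] fun v : E => v := isLittleO_norm_pow_id one_lt_two
    simpa [hf0] using hfo.trans h2
  have hline (u : E) : (fun h : ℝ => f (h • u)) =o[𝓝[>] 0] fun h => h ^ 2 := by
    have ht : Tendsto (fun h : ℝ => h • u) (𝓝[>] 0) (𝓝 0) := by
      have : Continuous fun h : ℝ => h • u := by fun_prop
      simpa using (this.tendsto 0).mono_left nhdsWithin_le_nhds
    refine (hfo.comp_tendsto ht).trans_isBigO ?_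
    refine IsBigO.of_bound (‖u‖ ^ 2) (Eventually.of_forall fun h => ?_)
    simp [norm_smul, mul_pow, mul_comm]
  have key (v w : E) : fderiv ℝ (fderiv ℝ f) 0 v w + fderiv ℝ (fderiv ℝ f) 0 w w / 2 = 0 := by
    have hT := (convex_univ (𝕜 := ℝ) (E := E)).taylor_approx_two_segment
      (f := f) (f' := fderiv ℝ f) (f'' := fderiv ℝ (fderiv ℝ f) 0) (x := 0) (v := v) (w := w)
      (fun x _ => (hdiff x).hasFDerivAt) (Set.mem_univ _) (hdiff' 0).hasFDerivAt.hasFDerivWithinAt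
      (by simp) (by simp)
    have h3 := ((hline (v + w)).sub (hline v)).sub hT
    have h4 : (fun h : ℝ => h ^ 2 *
        (fderiv ℝ (fderiv ℝ f) 0 v w + fderiv ℝ (fderiv ℝ f) 0 w w / 2))
        =o[𝓝[>] 0] fun h => h ^ 2 := by
      refine h3.congr_left fun h => ?_
      simp [hfderiv, smul_add]
      ring
    rw [isLittleO_iff_tendsto'] at h4
    · refine tendsto_nhds_unique (tendsto_const_nhds.congr' ?_) h4
      filter_upwards [self_mem_nhdsWithin] with h hh
      have : h ≠ 0 := ne_of_gt hh
      field_simp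
    · filter_upwards [self_mem_nhdsWithin] with h hh h0
      exact absurd h0 (pow_ne_zero 2 (ne_of_gt hh))
  have hsnd : fderiv ℝ (fderiv ℝ f) 0 = 0 := by
    ext v w
    have h1 := key v w
    have h2 := key 0 w
    simp only [map_zero, _root_.zero_apply] at h2 ⊢
    linarith
  have := (hdiff' 0).hasFDerivAt
  rw [hsnd, hasFDerivAt_iff_isLittleO_nhds_zero] at this
  simpa [hfderiv] using this

/-- Low order coefficients of a quartic polynomial which is `o(t²)` vanish. -/
lemma coeffs_eq_zero_of_isLittleO_sq {a b c d e : ℝ}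
    (h : (fun t : ℝ => a + b * t + c * t ^ 2 + d * t ^ 3 + e * t ^ 4) =o[𝓝 0] fun t => t ^ 2) :
    a = 0 ∧ b = 0 ∧ c = 0 := by
  have ht : Tendsto (fun t : ℝ => t) (𝓝[>] 0) (𝓝 0) := tendsto_id.mono_left nhdsWithin_le_nhds
  have hlim (f : ℝ → ℝ) (hf : Continuous f) : Tendsto f (𝓝[>] 0) (𝓝 (f 0)) :=
    (hf.tendsto 0).mono_left nhdsWithin_le_nhds
  have hq := (h.mono (nhdsWithin_le_nhds (s := Set.Ioi 0))).tendsto_div_nhds_zero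
  have ha : a = 0 := by
    have := h.isBigO.eq_zero_imp.self_of_nhds
    simpa using this
  subst ha
  have hb : b = 0 := by
    have h1 := hlim (fun t : ℝ => b + c * t + d * t ^ 2 + e * t ^ 3) (by fun_prop)
    have h2 := hq.mul ht
    have h3 := tendsto_nhds_unique h1 (h2.congr' ?_)
    · simpa using h3
    · filter_upwards [self_mem_nhdsWithin] with t ht
      have : t ≠ 0 := ne_of_gt ht
      field_simp
      ring
  subst hb
  have h1 := hlim (fun t : ℝ => c + d * t + e * t ^ 2) (by fun_prop)
  have h2 := tendsto_nhds_unique h1 (hq.congr' ?_)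
  · simpa using h2
  · filter_upwards [self_mem_nhdsWithin] with t ht
    have : t ≠ 0 := ne_of_gt ht
    field_simp
    ring

lemma Finsupp.sum_id_fin_two (d : Fin 2 →₀ ℕ) : (d.sum fun _ e => e) = d 0 + d 1 := by
  simp [Finsupp.sum_fintype]

lemma MvPolynomial.eq_quadratic_of_totalDegree_le_two {p : MvPolynomial (Fin 2) ℝ}
    (hp : p.totalDegree ≤ 2) : ∃ a b c d e f : ℝ,
      p = C a + C b * X 0 + C c * X 1 + C d * X 0 ^ 2 + C e * (X 0 * X 1) + C f * X 1 ^ 2 := by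
  have hX (i : Fin 2) : (X i : MvPolynomial (Fin 2) ℝ) = monomial (Finsupp.single i 1) 1 := rfl
  refine ⟨coeff 0 p, coeff (.single 0 1) p, coeff (.single 1 1) p, coeff (.single 0 2) p,
    coeff (.single 0 1 + .single 1 1) p, coeff (.single 1 2) p, ?_⟩
  ext m
  by_cases hm : m 0 + m 1 ≤ 2
  · have hm' : m = .single 0 (m 0) + .single 1 (m 1) := by
      ext i; fin_cases i <;> simp
    generalize m 0 = i at *
    generalize m 1 = j at *
    subst hm'
    simp only [hX, monomial_pow, monomial_mul, C_apply, Finsupp.smul_single, coeff_add,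
      coeff_monomial, Finsupp.ext_iff, Fin.forall_fin_two]
    have : i ≤ 2 := by omega
    have : j ≤ 2 := by omega
    interval_cases i <;> interval_cases j <;> first | omega | simp
  · rw [coeff_eq_zero_of_totalDegree_lt]
    · simp only [hX, monomial_pow, monomial_mul, C_apply, Finsupp.smul_single, coeff_add,
        coeff_monomial, Finsupp.ext_iff, Fin.forall_fin_two]
      simp
      repeat' rw [if_neg (by omega)]
      simp
    · have := Finsupp.sum_id_fin_two m
      rw [Finsupp.sum] at this
      omega

lemma mem_truncIdeal_X_sq_iff {p : MvPolynomial (Fin 2) ℝ} :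
    p ∈ truncIdeal 2 2 (fun _ : Fin 1 => (X 0 ^ 2 : MvPolynomial (Fin 2) ℝ)) ↔
      ∃ c : ℝ, p = C c * X 0 ^ 2 := by
  constructor
  · rintro ⟨hp, q, hq⟩
    obtain ⟨a, b, c, d, e, f, rfl⟩ := eq_quadratic_of_totalDegree_le_two hp
    have hX (i : Fin 2) : (X i : MvPolynomial (Fin 2) ℝ) = monomial (Finsupp.single i 1) 1 := rfl
    have h (i j : ℕ) (hij : i + j ≤ 2) (hi : i < 2) := hq (.single 0 i + .single 1 j)
      (by simpa [Finsupp.sum_id_fin_two] using hij)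
    simp only [hX, monomial_pow, monomial_mul, C_apply, Finsupp.smul_single, coeff_add,
      coeff_monomial, Finsupp.ext_iff, Fin.forall_fin_two, coeff_sub, Finset.univ_unique,
      Finset.sum_singleton, coeff_mul_monomial', Finsupp.single_le_iff] at h
    have h00 := h 0 0 (by norm_num) (by norm_num)
    have h10 := h 1 0 (by norm_num) (by norm_num)
    have h01 := h 0 1 (by norm_num) (by norm_num)
    have h11 := h 1 1 (by norm_num) (by norm_num)
    have h02 := h 0 2 (by norm_num) (by norm_num)
    simp at h00 h10 h01 h11 h02
    exact ⟨d, by simp [h00, h10, h01, h11, h02]⟩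
  · rintro ⟨c, rfl⟩
    refine ⟨?_, fun _ => C c, by simp⟩
    rw [X_pow_eq_monomial, C_mul_monomial]
    refine (totalDegree_monomial_le _ _).trans (by simp)

lemma C_mul_X_sq_mem_Im (c : ℝ) :
    (C c * X 0 ^ 2 : MvPolynomial (Fin 2) ℝ) ∈ Im 2 2 {v : Fin 2 → ℝ | v 0 ^ 2 = v 1 ^ 4} := by
  refine ⟨(mem_truncIdeal_X_sq_iff.2 ⟨c, rfl⟩).1, fun v => c * (v 0 ^ 2 - v 1 ^ 4), by fun_prop,
    fun v hv => ?_, ?_⟩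
  · rw [Set.mem_ofPred_eq] at hv
    simp [hv]
  · have h4 : (fun v : Fin 2 → ℝ => ‖v‖ ^ 4) =o[𝓝 0] fun v => ‖v‖ ^ 2 := by
      have := (isLittleO_pow_pow (𝕜 := ℝ) (m := 2) (n := 4) (by norm_num)).comp_tendsto
        (tendsto_norm_zero (E := Fin 2 → ℝ))
      exact this
    refine IsBigO.trans_isLittleO (IsBigO.of_bound |c| (Eventually.of_forall fun v => ?_)) h4
    have : c * (v 0 ^ 2 - v 1 ^ 4) - eval v (C c * X 0 ^ 2) = - (c * v 1 ^ 4) := by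
      simp; ring
    rw [this, norm_neg, norm_mul, norm_pow, norm_pow, norm_norm, Real.norm_eq_abs c]
    gcongr
    exact norm_le_pi_norm v 1

lemma exists_eq_C_mul_X_sq_of_mem_Im {p : MvPolynomial (Fin 2) ℝ}
    (hp : p ∈ Im 2 2 {v : Fin 2 → ℝ | v 0 ^ 2 = v 1 ^ 4}) : ∃ c : ℝ, p = C c * X 0 ^ 2 := by
  obtain ⟨hdeg, F, hF, hFE, ho⟩ := hp
  obtain ⟨a, b, c, d, e, f, rfl⟩ := eq_quadratic_of_totalDegree_le_two hdeg
  set H : (Fin 2 → ℝ) → ℝ := fun v => F v -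
    (a + b * v 0 + c * v 1 + d * v 0 ^ 2 + e * (v 0 * v 1) + f * v 1 ^ 2) with hH
  have hHo : H =o[𝓝 0] fun v => ‖v‖ ^ 2 := ho.congr_left fun v => by simp [hH]
  have hHc : ContDiff ℝ 2 H := by
    have : ContDiff ℝ 2 F := hF
    fun_prop
  have hHE (s t : ℝ) (hs : s ^ 2 = 1) : H ![s * t ^ 2, t] =
      -(a + c * t + (s * b + f) * t ^ 2 + s * e * t ^ 3 + d * t ^ 4) := by
    have h0 : F ![s * t ^ 2, t] = 0 := hFE _ (by simp [mul_pow, hs]; ring)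
    simp only [hH, h0, Matrix.cons_val_zero, Matrix.cons_val_one]
    linear_combination (-d * t ^ 4) * hs
  have hnorm (s t : ℝ) (hs : s ^ 2 = 1) (ht : |t| ≤ 1) : ‖![s * t ^ 2, t]‖ ≤ |t| := by
    rw [pi_norm_le_iff_of_nonneg (abs_nonneg t), Fin.forall_fin_two]
    have hs' : |s| = 1 := by
      simpa using (sq_eq_sq_iff_abs_eq_abs s 1).1 (by simpa using hs)
    simp only [Matrix.cons_val_zero, Matrix.cons_val_one, Real.norm_eq_abs, abs_mul, abs_pow, hs',
      le_refl, and_true]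
    nlinarith [abs_nonneg t]
  have hlow (s : ℝ) (hs : s ^ 2 = 1) : a = 0 ∧ c = 0 ∧ s * b + f = 0 := by
    apply coeffs_eq_zero_of_isLittleO_sq (d := s * e) (e := d)
    have ht : Tendsto (fun t : ℝ => ![s * t ^ 2, t]) (𝓝 0) (𝓝 0) := by
      have : Continuous fun t : ℝ => ![s * t ^ 2, t] := by fun_prop
      have h0 : ![s * 0 ^ 2, 0] = 0 := by ext i; fin_cases i <;> simp
      simpa only [h0] using this.tendsto 0
    refine ((hHo.comp_tendsto ht).neg_left.trans_isBigO (g := fun v => ‖![s * v ^ 2, v]‖ ^ 2)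
      (k := fun t => t ^ 2) ?_).congr_left fun t => ?_
    · refine IsBigO.of_bound 1 ?_
      filter_upwards [Metric.closedBall_mem_nhds (0 : ℝ) one_pos] with t ht
      have := hnorm s t hs (by simpa using ht)
      rw [norm_pow, norm_norm, norm_pow, one_mul, Real.norm_eq_abs]
      gcongr
    · simp only [Function.comp_apply, hHE s t hs, neg_neg]
  obtain ⟨ha, hc, h1⟩ := hlow 1 (by norm_num)
  obtain ⟨-, -, h2⟩ := hlow (-1) (by norm_num)
  have hb : b = 0 := by linarith
  have hf : f = 0 := by linarith
  have he : e = 0 := by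
    rw [← abs_nonpos_iff]
    refine le_of_forall_pos_le_add fun ε hε => ?_
    have hD := hHc.isLittleO_fderiv_of_isLittleO_sq hHo
    obtain ⟨δ, hδ, hball⟩ := Metric.eventually_nhds_iff_ball.1 (isLittleO_iff.1 hD hε)
    obtain ⟨t, ht0, ht⟩ := exists_between (lt_min hδ one_pos)
    have htδ : t < δ := ht.trans_le (min_le_left _ _)
    have ht1 : |t| ≤ 1 := by rw [abs_of_pos ht0]; exact (ht.trans_le (min_le_right _ _)).le
    have hmem (s : ℝ) (hs : s ^ 2 = 1) :
        ![s * t ^ 2, t] ∈ Metric.closedBall (0 : Fin 2 → ℝ) t := by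
      simpa [abs_of_pos ht0] using hnorm s t hs ht1
    have hmv := (convex_closedBall (0 : Fin 2 → ℝ) t).norm_image_sub_le_of_norm_fderiv_le
      (𝕜 := ℝ) (f := H) (C := ε * t)
      (fun x _ => (hHc.differentiable (by norm_num)) x)
      (fun x hx => (hball x (Metric.closedBall_subset_ball htδ hx)).trans
        (by gcongr; simpa using hx))
      (hmem (-1) (by norm_num)) (hmem 1 (by norm_num))
    rw [hHE 1 t (by norm_num), hHE (-1) t (by norm_num)] at hmv
    have hdiff : ‖![1 * t ^ 2, t] - ![-1 * t ^ 2, t]‖ ≤ 2 * t ^ 2 := by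
      rw [pi_norm_le_iff_of_nonneg (by positivity), Fin.forall_fin_two]
      constructor
      · simp [← two_mul]
      · simp; positivity
    have hval : ‖-(a + c * t + (1 * b + f) * t ^ 2 + 1 * e * t ^ 3 + d * t ^ 4) -
        -(a + c * t + (-1 * b + f) * t ^ 2 + -1 * e * t ^ 3 + d * t ^ 4)‖ = |e| * (2 * t ^ 3) := by
      rw [hb, ← abs_of_pos (show 0 < 2 * t ^ 3 by positivity), ← abs_mul, Real.norm_eq_abs,
        ← abs_neg]
      congr 1
      ring
    rw [hval] at hmv
    have hfin : |e| * (2 * t ^ 3) ≤ ε * (2 * t ^ 3) := by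
      calc _ ≤ _ := hmv
        _ ≤ ε * t * (2 * t ^ 2) := by gcongr
        _ = _ := by ring
    simpa using le_of_mul_le_mul_right hfin (by positivity)
  exact ⟨d, by simp [ha, hb, hc, he, hf]⟩

/-- For `E = {x² = y⁴} ⊆ ℝ²` one has `I²(E) = ⟨x²⟩₂`; in particular `xy ∉ I²(E)`. -/
theorem stmt12 :
    Im 2 2 {v : Fin 2 → ℝ | v 0 ^ 2 = v 1 ^ 4} =
        truncIdeal 2 2 (fun _ : Fin 1 => (X 0 ^ 2 : MvPolynomial (Fin 2) ℝ)) ∧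
      (X 0 * X 1 : MvPolynomial (Fin 2) ℝ) ∉ Im 2 2 {v : Fin 2 → ℝ | v 0 ^ 2 = v 1 ^ 4} := by
  have hIm : Im 2 2 {v : Fin 2 → ℝ | v 0 ^ 2 = v 1 ^ 4} =
      truncIdeal 2 2 (fun _ : Fin 1 => (X 0 ^ 2 : MvPolynomial (Fin 2) ℝ)) := by
    ext p
    rw [mem_truncIdeal_X_sq_iff]
    refine ⟨exists_eq_C_mul_X_sq_of_mem_Im, ?_⟩
    rintro ⟨c, rfl⟩
    exact C_mul_X_sq_mem_Im c
  refine ⟨hIm, fun h => ?_⟩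
  obtain ⟨c, hc⟩ := exists_eq_C_mul_X_sq_of_mem_Im h
  have h1 := congrArg (eval ![1, 1]) hc
  have h2 := congrArg (eval ![1, 0]) hc
  simp at h1 h2
  linarith
end
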